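/- arXiv:2203.01599 — 2 statements merged into one kernel-verified Lean document; each statement's English description precedes it below -/
import Mathlib

section
/- Let d = 2^ℓ, let ε, δ ∈ (0, 1/2), let x_1, …, x_n ∈ ℝ^d and let q ∈ ℝ^d. Set α = Φ(3) and ψ_r(x) = min(|x|, r). There are absolute constants C, c > 0 such that if m ≥ C ε⁻² log⁵(d/ε) log(1/δ) and k ≥ C ε⁻² (log n + log(1/δ)) log^c(d/(εδ)), then the following holds: let y = h̃(q), y_i = h̃(x_i), let l_1, …, l_k be i.i.d. uniform on [md] (independent of everything else), let r_i = 2√(log(1/ε)) · quant_α({y_{l_p} − (y_i)_{l_p}}_{p∈[k]}) and d_i = (1/k)·√(π/2)·Σ_{p=1}^k ψ_{r_i}(y_{l_p} − (y_i)_{l_p}); then with probability at least 1 − δ, for every i ∈ [n], (1 − ε)‖q − x_i‖ ≤ d_i ≤ (1 + ε)‖q − x_i‖. -/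
open MeasureTheory ProbabilityTheory Real
open scoped ENNReal NNReal Classical

noncomputable section

/-- The Sylvester–Hadamard matrix of size `2^ℓ`: `H 0 = [1]`,
`H (ℓ+1) = [[H ℓ, H ℓ],[H ℓ, -H ℓ]]`. -/
def Had : ∀ ℓ : ℕ, Matrix (Fin (2 ^ ℓ)) (Fin (2 ^ ℓ)) ℝ
  | 0 => 1
  | (ℓ + 1) =>
      Matrix.reindex (finSumFinEquiv.trans (finCongr (by rw [pow_succ, mul_two])))
        (finSumFinEquiv.trans (finCongr (by rw [pow_succ, mul_two])))
        (Matrix.fromBlocks (Had ℓ) (Had ℓ) (Had ℓ) (-(Had ℓ)))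

/-- `rht ℓ m D z j k = (H_d D^j z)_k`, the `(j,k)` entry of the randomized Hadamard
transform of `z`, where `D j` records the diagonal entries of the diagonal matrix `D^j`. -/
def rht (ℓ m : ℕ) (D : Fin m → Fin (2 ^ ℓ) → ℝ) (z : EuclideanSpace ℝ (Fin (2 ^ ℓ)))
    (j : Fin m) (k : Fin (2 ^ ℓ)) : ℝ :=
  (Had ℓ).mulVec (fun i => D j i * z i) k

/-- The joint law of the diagonal entries of `D^1, …, D^m`: i.i.d. standard Gaussians. -/
def diagMeasure (ℓ m : ℕ) : Measure (Fin m → Fin (2 ^ ℓ) → ℝ) :=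
  Measure.pi fun _ => Measure.pi fun _ => gaussianReal 0 1

/-- For `α ∈ (0,1)` and a finite family `v : ι → ℝ`, `quant α v` is the α-th quantile:
the smallest value `s` of the family such that at least an `α` fraction of the family
is `≤ s`. -/
def quant {ι : Type*} [Fintype ι] (α : ℝ) (v : ι → ℝ) : ℝ :=
  sInf {s | s ∈ Set.range v ∧
    α * (Fintype.card ι : ℝ) ≤ ((Finset.univ.filter fun p => v p ≤ s).card : ℝ)}

/-- `Φ(3)`, where `Φ` is the standard Gaussian CDF. -/
def gaussAlpha : ℝ := ((gaussianReal 0 1) (Set.Iic (3 : ℝ))).toReal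

/-- Uniform distribution over the `m·d` indices (as pairs `(j,k)`). -/
def unifIndex (ℓ m : ℕ) : Measure (Fin m × Fin (2 ^ ℓ)) :=
  ((m * 2 ^ ℓ : ℕ) : ℝ≥0∞)⁻¹ • Measure.count

/-- The joint law of `k` i.i.d. uniform indices in `[md]`. -/
def indexMeasure (ℓ m k : ℕ) : Measure (Fin k → Fin m × Fin (2 ^ ℓ)) :=
  Measure.pi fun _ => unifIndex ℓ m

/-- The distance estimate `d_i` produced by the query procedure, where
`ψ_r(x) = min(|x|, r)` and `r_i = 2√(log(1/ε))·quant_α({y_{l_p} − (y_i)_{l_p}})`. -/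
def distEstimate (ℓ m k : ℕ) (ε : ℝ) (D : Fin m → Fin (2 ^ ℓ) → ℝ)
    (L : Fin k → Fin m × Fin (2 ^ ℓ)) (q xi : EuclideanSpace ℝ (Fin (2 ^ ℓ))) : ℝ :=
  (1 / (k : ℝ)) * Real.sqrt (Real.pi / 2) *
    ∑ p, min |rht ℓ m D q (L p).1 (L p).2 - rht ℓ m D xi (L p).1 (L p).2|
      (2 * Real.sqrt (Real.log (1 / ε)) *
        quant gaussAlpha fun p' : Fin k =>
          rht ℓ m D q (L p').1 (L p').2 - rht ℓ m D xi (L p').1 (L p').2)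

/-- A coordinatewise measure preserving transformation of pairs preserves the product law. -/
lemma measurePreserving_prod_pi {ι : Type*} [Fintype ι] {α : Type*} [MeasurableSpace α]
    (μ : Measure α) [SigmaFinite μ] (R : ι → α × α → α × α)
    (hR : ∀ i, MeasurePreserving (R i) (μ.prod μ) (μ.prod μ)) :
    MeasurePreserving
      (fun p : (ι → α) × (ι → α) =>
        ((fun i => (R i (p.1 i, p.2 i)).1, fun i => (R i (p.1 i, p.2 i)).2) :
          (ι → α) × (ι → α)))
      ((Measure.pi fun _ => μ).prod (Measure.pi fun _ => μ))
      ((Measure.pi fun _ => μ).prod (Measure.pi fun _ => μ)) := by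
  have h := measurePreserving_arrowProdEquivProdArrow α α ι (fun _ => μ) (fun _ => μ)
  have h2 := measurePreserving_pi (fun _ : ι => μ.prod μ) (fun _ => μ.prod μ) hR
  exact h.comp (h2.comp h.symm)

lemma measurePreserving_rotation_gaussianReal (θ : ℝ) :
    MeasurePreserving
      (fun p : ℝ × ℝ => (cos θ * p.1 + sin θ * p.2, -sin θ * p.1 + cos θ * p.2))
      ((gaussianReal 0 1).prod (gaussianReal 0 1))
      ((gaussianReal 0 1).prod (gaussianReal 0 1)) := by
  refine ⟨by fun_prop, ?_⟩
  have h := IsGaussian.map_rotation_eq_self (μ := gaussianReal 0 1) (by simp) θ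
  exact h

lemma measurePreserving_rotation_diag (ℓ m : ℕ) (θ : ℝ) :
    MeasurePreserving
      (fun p : (Fin m → Fin (2 ^ ℓ) → ℝ) × (Fin m → Fin (2 ^ ℓ) → ℝ) =>
        (cos θ • p.1 + sin θ • p.2, -sin θ • p.1 + cos θ • p.2))
      ((diagMeasure ℓ m).prod (diagMeasure ℓ m)) ((diagMeasure ℓ m).prod (diagMeasure ℓ m)) :=
  measurePreserving_prod_pi _ _ fun _ =>
    measurePreserving_prod_pi _ _ fun _ => measurePreserving_rotation_gaussianReal θ

instance isProbabilityMeasure_diagMeasure (ℓ m : ℕ) :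
    IsProbabilityMeasure (diagMeasure ℓ m) := by
  unfold diagMeasure; infer_instance

/-- Resampling the coordinates outside `S` preserves the law of the diagonals. -/
lemma measurePreserving_resample (ℓ m : ℕ) (S : Finset (Fin (2 ^ ℓ))) :
    MeasurePreserving
      (fun p : (Fin m → Fin (2 ^ ℓ) → ℝ) × (Fin m → Fin (2 ^ ℓ) → ℝ) =>
        fun j i => if i ∈ S then p.1 j i else p.2 j i)
      ((diagMeasure ℓ m).prod (diagMeasure ℓ m)) (diagMeasure ℓ m) := by
  have h : MeasurePreserving _ ((diagMeasure ℓ m).prod (diagMeasure ℓ m))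
      ((diagMeasure ℓ m).prod (diagMeasure ℓ m)) :=
    measurePreserving_prod_pi _
      (fun _ (p : (Fin (2 ^ ℓ) → ℝ) × (Fin (2 ^ ℓ) → ℝ)) =>
        (fun i => ((if i ∈ S then id else Prod.swap : ℝ × ℝ → ℝ × ℝ) (p.1 i, p.2 i)).1,
        fun i => ((if i ∈ S then id else Prod.swap : ℝ × ℝ → ℝ × ℝ) (p.1 i, p.2 i)).2)) fun _ =>
      measurePreserving_prod_pi _ (fun i => (if i ∈ S then id else Prod.swap)) fun i => by
        split_ifs
        · exact MeasurePreserving.id _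
        · exact Measure.measurePreserving_swap
  have h2 := (measurePreserving_fst (μ := diagMeasure ℓ m) (ν := diagMeasure ℓ m)).comp h
  convert h2 using 1
  funext p j i
  by_cases hi : i ∈ S <;> simp [hi]

lemma integrable_prod_diag (ℓ m : ℕ) (h : Fin m → Fin (2 ^ ℓ) → ℝ → ℝ)
    (hh : ∀ j i, Integrable (h j i) (gaussianReal 0 1)) :
    Integrable (fun D => ∏ j, ∏ i, h j i (D j i)) (diagMeasure ℓ m) :=
  Integrable.fintype_prod (f := fun j (x : Fin (2 ^ ℓ) → ℝ) => ∏ i, h j i (x i)) fun j =>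
    Integrable.fintype_prod (f := h j) (hh j)

lemma integral_prod_diag (ℓ m : ℕ) (h : Fin m → Fin (2 ^ ℓ) → ℝ → ℝ) :
    ∫ D, ∏ j, ∏ i, h j i (D j i) ∂(diagMeasure ℓ m)
      = ∏ j, ∏ i, ∫ x, h j i x ∂(gaussianReal 0 1) := by
  unfold diagMeasure
  rw [integral_fintype_prod_eq_prod (f := fun j (x : Fin (2 ^ ℓ) → ℝ) => ∏ i, h j i (x i))]
  exact Finset.prod_congr rfl fun j _ => integral_fintype_prod_eq_prod (f := h j)

/-- Gaussian linear forms: the exponential moment under the law of the diagonals. -/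
lemma lintegral_exp_linear_diag (ℓ m : ℕ) (w : Fin m → Fin (2 ^ ℓ) → ℝ) :
    ∫⁻ D, ENNReal.ofReal (exp (∑ j, ∑ i, w j i * D j i)) ∂(diagMeasure ℓ m)
      = ENNReal.ofReal (exp ((∑ j, ∑ i, w j i ^ 2) / 2)) := by
  have he : ∀ D : Fin m → Fin (2 ^ ℓ) → ℝ,
      exp (∑ j, ∑ i, w j i * D j i) = ∏ j, ∏ i, exp (w j i * D j i) := fun D => by
    simp_rw [exp_sum]
  simp_rw [he]
  have hm : ∀ t : ℝ, ∫ x, exp (t * x) ∂(gaussianReal 0 1) = exp (t ^ 2 / 2) := fun t => by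
    have := congrFun (mgf_id_gaussianReal (μ := 0) (v := 1)) t
    simpa [mgf] using this
  rw [← ofReal_integral_eq_lintegral_ofReal
      (integrable_prod_diag ℓ m (fun j i x => exp (w j i * x))
        fun j i => integrable_exp_mul_gaussianReal _)
      (ae_of_all _ fun D => Finset.prod_nonneg fun _ _ => Finset.prod_nonneg fun _ _ =>
        (exp_pos _).le),
    integral_prod_diag ℓ m (fun j i x => exp (w j i * x))]
  simp_rw [hm, ← exp_sum, Finset.sum_div]

/-- Jensen's inequality for the exponential on the interval `[0, π/2]`. -/
lemma exp_integral_le_integral_exp {u : ℝ → ℝ} (hu : Continuous u) :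
    exp (∫ θ in (0 : ℝ)..(π / 2), u θ)
      ≤ (2 / π) * ∫ θ in (0 : ℝ)..(π / 2), exp ((π / 2) * u θ) := by
  set A := ∫ θ in (0 : ℝ)..(π / 2), u θ with hA
  have hpi := Real.pi_pos
  have h1 : ∫ θ in (0 : ℝ)..(π / 2), exp A * (1 + ((π / 2) * u θ - A))
      ≤ ∫ θ in (0 : ℝ)..(π / 2), exp ((π / 2) * u θ) := by
    refine intervalIntegral.integral_mono_on (by positivity)
      (Continuous.intervalIntegrable (by fun_prop) _ _)
      (Continuous.intervalIntegrable (by fun_prop) _ _) fun θ _ => ?_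
    have := add_one_le_exp ((π / 2) * u θ - A)
    calc exp A * (1 + ((π / 2) * u θ - A)) ≤ exp A * exp ((π / 2) * u θ - A) := by
          gcongr; linarith
      _ = _ := by rw [← exp_add]; ring_nf
  have h2 : ∫ θ in (0 : ℝ)..(π / 2), exp A * (1 + ((π / 2) * u θ - A)) = (π / 2) * exp A := by
    rw [intervalIntegral.integral_const_mul, intervalIntegral.integral_add (by simp)
      (Continuous.intervalIntegrable (by fun_prop) _ _),
      intervalIntegral.integral_sub (Continuous.intervalIntegrable (by fun_prop) _ _) (by simp),
      intervalIntegral.integral_const_mul, ← hA]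
    simp
    ring
  rw [h2] at h1
  calc exp A = (2 / π) * ((π / 2) * exp A) := by field_simp
    _ ≤ _ := by gcongr

set_option maxHeartbeats 400000 in
/-- **Maurey–Pisier**: exponential moments of increments of a `C¹` function under a
rotation invariant law are controlled by those of its differential. -/
theorem lintegral_exp_sub_le_of_rotation_invariant {E : Type*} [NormedAddCommGroup E]
    [NormedSpace ℝ E] [MeasurableSpace E] [BorelSpace E] [SecondCountableTopology E]
    (μ : Measure E) [IsProbabilityMeasure μ]
    (hrot : ∀ θ : ℝ, MeasurePreserving
      (fun p : E × E => (cos θ • p.1 + sin θ • p.2, -sin θ • p.1 + cos θ • p.2))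
      (μ.prod μ) (μ.prod μ))
    {G : E → ℝ} {G' : E → E →L[ℝ] ℝ} (hG : ∀ x, HasFDerivAt G (G' x) x) (hG' : Continuous G')
    {v : ℝ} (hv : ∀ x (s : ℝ), ∫⁻ y, ENNReal.ofReal (exp (s * G' x y)) ∂μ
      ≤ ENNReal.ofReal (exp (s ^ 2 * v / 2))) (s : ℝ) :
    ∫⁻ p, ENNReal.ofReal (exp (s * (G p.2 - G p.1))) ∂(μ.prod μ)
      ≤ ENNReal.ofReal (exp (s ^ 2 * π ^ 2 * v / 8)) := by
  have hpi := Real.pi_pos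
  set Ψ : E × E → ℝ := fun p => exp ((π / 2) * (s * G' p.1 p.2)) with hΨ
  have hΨc : Continuous Ψ := by
    have : Continuous fun p : E × E => G' p.1 p.2 :=
      (hG'.comp continuous_fst).clm_apply continuous_snd
    fun_prop
  let R : ℝ → E × E → E × E :=
    fun θ p => (cos θ • p.1 + sin θ • p.2, -sin θ • p.1 + cos θ • p.2)
  have hRc : Continuous fun q : ℝ × (E × E) => R q.1 q.2 := by fun_prop
  have hpt : ∀ p : E × E, ENNReal.ofReal (exp (s * (G p.2 - G p.1)))
      ≤ ENNReal.ofReal (2 / π) *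
        ∫⁻ θ in Set.Ioc 0 (π / 2), ENNReal.ofReal (Ψ (R θ p)) := by
    intro p
    have hd : ∀ θ : ℝ, HasDerivAt (fun θ => G (R θ p).1) (G' (R θ p).1 (R θ p).2) θ := by
      intro θ
      have h1 : HasDerivAt (fun θ => (R θ p).1) (R θ p).2 θ := by
        have := ((hasDerivAt_cos θ).smul_const p.1).add ((hasDerivAt_sin θ).smul_const p.2)
        exact this
      exact (hG _).comp_hasDerivAt θ h1
    have hc1 : Continuous fun θ => R θ p :=
      hRc.comp (Continuous.prodMk continuous_id continuous_const)
    have hc : Continuous fun θ => G' (R θ p).1 (R θ p).2 :=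
      (hG'.comp (continuous_fst.comp hc1)).clm_apply (continuous_snd.comp hc1)
    have hint := intervalIntegral.integral_eq_sub_of_hasDerivAt (a := 0) (b := π / 2)
      (fun θ _ => hd θ) (hc.intervalIntegrable _ _)
    have hval : G (R (π / 2) p).1 - G (R 0 p).1 = G p.2 - G p.1 := by simp [R]
    rw [← hval, ← hint, ← intervalIntegral.integral_const_mul]
    refine (ENNReal.ofReal_le_ofReal (exp_integral_le_integral_exp (by fun_prop))).trans ?_
    rw [ENNReal.ofReal_mul (by positivity), intervalIntegral.integral_of_le (by positivity),
      ofReal_integral_eq_lintegral_ofReal]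
    · exact (Continuous.integrableOn_Icc (by fun_prop)).mono_set Set.Ioc_subset_Icc_self
    · exact ae_of_all _ fun _ => (exp_pos _).le
  have hmeas : Measurable fun q : (E × E) × ℝ => ENNReal.ofReal (Ψ (R q.2 q.1)) := by
    have : Continuous fun q : (E × E) × ℝ => Ψ (R q.2 q.1) :=
      hΨc.comp (hRc.comp (continuous_snd.prodMk continuous_fst))
    exact this.measurable.ennreal_ofReal
  have hθ : ∀ θ : ℝ, ∫⁻ p, ENNReal.ofReal (Ψ (R θ p)) ∂(μ.prod μ)
      ≤ ENNReal.ofReal (exp (s ^ 2 * π ^ 2 * v / 8)) := by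
    intro θ
    rw [(hrot θ).lintegral_comp (f := fun p => ENNReal.ofReal (Ψ p))
      hΨc.measurable.ennreal_ofReal,
      lintegral_prod _ hΨc.measurable.ennreal_ofReal.aemeasurable]
    calc ∫⁻ x, ∫⁻ y, ENNReal.ofReal (Ψ (x, y)) ∂μ ∂μ
        ≤ ∫⁻ x, ENNReal.ofReal (exp (s ^ 2 * π ^ 2 * v / 8)) ∂μ := by
          refine lintegral_mono fun x => ?_
          convert hv x (π / 2 * s) using 3
          · simp only [hΨ]; ring_nf
          · ring_nf
      _ = _ := by simp
  calc ∫⁻ p, ENNReal.ofReal (exp (s * (G p.2 - G p.1))) ∂(μ.prod μ)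
      ≤ ∫⁻ p, ENNReal.ofReal (2 / π) *
          (∫⁻ θ in Set.Ioc 0 (π / 2), ENNReal.ofReal (Ψ (R θ p))) ∂(μ.prod μ) :=
        lintegral_mono hpt
    _ = ENNReal.ofReal (2 / π) *
          ∫⁻ θ in Set.Ioc 0 (π / 2), ∫⁻ p, ENNReal.ofReal (Ψ (R θ p)) ∂(μ.prod μ) := by
        rw [lintegral_const_mul' _ _ ENNReal.ofReal_ne_top,
          lintegral_lintegral_swap hmeas.aemeasurable]
    _ ≤ ENNReal.ofReal (2 / π) *
          ∫⁻ θ in Set.Ioc 0 (π / 2), ENNReal.ofReal (exp (s ^ 2 * π ^ 2 * v / 8)) := by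
        gcongr with θ; exact hθ θ
    _ = ENNReal.ofReal (exp (s ^ 2 * π ^ 2 * v / 8)) := by
        rw [setLIntegral_const, Real.volume_Ioc, mul_left_comm,
          ← ENNReal.ofReal_mul (by positivity)]
        rw [show 2 / π * (π / 2 - 0) = 1 by field_simp; ring]
        simp

/-- **Gaussian concentration** for bounded `C¹` functions. -/
theorem measureReal_sub_integral_ge_le {E : Type*} [NormedAddCommGroup E]
    [NormedSpace ℝ E] [MeasurableSpace E] [BorelSpace E] [SecondCountableTopology E]
    (μ : Measure E) [IsProbabilityMeasure μ]
    (hrot : ∀ θ : ℝ, MeasurePreserving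
      (fun p : E × E => (cos θ • p.1 + sin θ • p.2, -sin θ • p.1 + cos θ • p.2))
      (μ.prod μ) (μ.prod μ))
    {G : E → ℝ} {G' : E → E →L[ℝ] ℝ} (hG : ∀ x, HasFDerivAt G (G' x) x) (hG' : Continuous G')
    {v : ℝ} (hv0 : 0 ≤ v) (hv : ∀ x (s : ℝ), ∫⁻ y, ENNReal.ofReal (exp (s * G' x y)) ∂μ
      ≤ ENNReal.ofReal (exp (s ^ 2 * v / 2)))
    {B : ℝ} (hB : ∀ x, |G x| ≤ B) {t : ℝ} (ht : 0 ≤ t) :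
    μ.real {x | t ≤ G x - ∫ y, G y ∂μ} ≤ exp (-t ^ 2 / (π ^ 2 * v / 2)) := by
  have hGc : Continuous G := continuous_iff_continuousAt.2 fun x => (hG x).continuousAt
  have hGi : Integrable G μ :=
    Integrable.of_bound hGc.aestronglyMeasurable B (ae_of_all _ hB)
  have hb : ∀ s x, exp (s * (G x - ∫ y, G y ∂μ)) ≤ exp (|s| * (B + |∫ y, G y ∂μ|)) := by
    intro s x
    refine exp_le_exp.2 ?_
    calc s * (G x - ∫ y, G y ∂μ) ≤ |s * (G x - ∫ y, G y ∂μ)| := le_abs_self _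
      _ = |s| * |G x - ∫ y, G y ∂μ| := abs_mul _ _
      _ ≤ _ := by
        gcongr
        exact (abs_sub _ _).trans (add_le_add (hB x) le_rfl)
  have hei : ∀ s, Integrable (fun x => exp (s * (G x - ∫ y, G y ∂μ))) μ := fun s =>
    Integrable.of_bound (by fun_prop) (exp (|s| * (B + |∫ y, G y ∂μ|)))
      (ae_of_all _ fun x => by rw [norm_of_nonneg (exp_pos _).le]; exact hb s x)
  have hsub : HasSubgaussianMGF (fun x => G x - ∫ y, G y ∂μ) (π ^ 2 * v / 4).toNNReal μ := by
    refine ⟨hei, fun s => ?_⟩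
    rw [Real.coe_toNNReal _ (by positivity), mgf]
    have h1 := lintegral_exp_sub_le_of_rotation_invariant μ hrot hG hG' hv s
    rw [lintegral_prod_symm _ (by fun_prop)] at h1
    have h2 : ∀ y, ENNReal.ofReal (exp (s * (G y - ∫ x, G x ∂μ)))
        ≤ ∫⁻ x, ENNReal.ofReal (exp (s * (G y - G x))) ∂μ := by
      intro y
      have hi2 : Integrable (fun x => exp (s * (G y - G x))) μ :=
        Integrable.of_bound (by fun_prop) (exp (|s| * (B + B)))
          (ae_of_all _ fun x => by
            rw [norm_of_nonneg (exp_pos _).le]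
            refine exp_le_exp.2 ((le_abs_self _).trans ?_)
            rw [abs_mul]
            gcongr
            exact (abs_sub _ _).trans (add_le_add (hB y) (hB x)))
      rw [← ofReal_integral_eq_lintegral_ofReal hi2 (ae_of_all _ fun _ => (exp_pos _).le)]
      refine ENNReal.ofReal_le_ofReal ?_
      set c := s * (G y - ∫ x, G x ∂μ) with hc
      have : ∫ x, exp c * (1 + (s * (G y - G x) - c)) ∂μ ≤ ∫ x, exp (s * (G y - G x)) ∂μ := by
        refine integral_mono (by fun_prop) hi2 fun x => ?_
        have := add_one_le_exp (s * (G y - G x) - c)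
        calc exp c * (1 + (s * (G y - G x) - c)) ≤ exp c * exp (s * (G y - G x) - c) := by
              gcongr; linarith
          _ = _ := by rw [← exp_add]; ring_nf
      refine le_trans (le_of_eq ?_) this
      rw [integral_const_mul, integral_add (by fun_prop) (by fun_prop),
        integral_sub (by fun_prop) (by fun_prop), integral_const_mul,
        integral_sub (by fun_prop) hGi]
      simp [hc]
    have h3 := (lintegral_mono h2).trans h1
    rw [← ofReal_integral_eq_lintegral_ofReal (hei s) (ae_of_all _ fun _ => (exp_pos _).le),
      ENNReal.ofReal_le_ofReal_iff (exp_pos _).le] at h3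
    refine h3.trans (le_of_eq ?_)
    ring_nf
  refine (hsub.measure_ge_le ht).trans (le_of_eq ?_)
  rw [Real.coe_toNNReal _ (by positivity)]
  ring_nf

lemma Had_sq (ℓ : ℕ) (k i : Fin (2 ^ ℓ)) : Had ℓ k i ^ 2 = 1 := by
  induction ℓ with
  | zero =>
    have : k = i := Subsingleton.elim (α := Fin 1) k i
    subst this
    simp [Had, Matrix.one_apply_eq]
  | succ ℓ ih =>
    simp only [Had, Matrix.reindex_apply, Matrix.submatrix_apply]
    rcases (finSumFinEquiv.trans (finCongr (by rw [pow_succ, mul_two] :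
      2 ^ ℓ + 2 ^ ℓ = 2 ^ (ℓ + 1)))).symm k with a | a <;>
    rcases (finSumFinEquiv.trans (finCongr (by rw [pow_succ, mul_two] :
      2 ^ ℓ + 2 ^ ℓ = 2 ^ (ℓ + 1)))).symm i with b | b <;> simp [ih]

lemma Had_mul_transpose (ℓ : ℕ) : Had ℓ * (Had ℓ).transpose = (2 ^ ℓ : ℝ) • 1 := by
  induction ℓ with
  | zero => simp [Had]
  | succ ℓ ih =>
    simp only [Had, Matrix.reindex_apply, Matrix.transpose_submatrix, Matrix.submatrix_mul_equiv,
      Matrix.fromBlocks_transpose, Matrix.fromBlocks_multiply, ih, Matrix.transpose_neg,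
      Matrix.mul_neg, Matrix.neg_mul, neg_neg]
    have : Matrix.fromBlocks ((2 ^ ℓ : ℝ) • (1 : Matrix (Fin (2 ^ ℓ)) (Fin (2 ^ ℓ)) ℝ)
        + (2 ^ ℓ : ℝ) • (1 : Matrix (Fin (2 ^ ℓ)) (Fin (2 ^ ℓ)) ℝ))
        ((2 ^ ℓ : ℝ) • (1 : Matrix (Fin (2 ^ ℓ)) (Fin (2 ^ ℓ)) ℝ) + -((2 ^ ℓ : ℝ) • 1))
        ((2 ^ ℓ : ℝ) • (1 : Matrix (Fin (2 ^ ℓ)) (Fin (2 ^ ℓ)) ℝ) + -((2 ^ ℓ : ℝ) • 1))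
        ((2 ^ ℓ : ℝ) • (1 : Matrix (Fin (2 ^ ℓ)) (Fin (2 ^ ℓ)) ℝ) + (2 ^ ℓ : ℝ) • 1)
        = (2 ^ (ℓ + 1) : ℝ) • (1 : Matrix (Fin (2 ^ ℓ) ⊕ Fin (2 ^ ℓ)) _ ℝ) := by
      rw [← Matrix.fromBlocks_one (l := Fin (2 ^ ℓ)) (m := Fin (2 ^ ℓ)), Matrix.fromBlocks_smul]
      simp only [← add_smul, pow_succ, mul_two, add_neg_cancel, smul_zero]
    rw [this, Matrix.submatrix_smul]
    ext a b
    simp [Matrix.one_apply]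

lemma sum_sq_vecMul_Had (ℓ : ℕ) (u : Fin (2 ^ ℓ) → ℝ) :
    ∑ i, (∑ k, u k * Had ℓ k i) ^ 2 = 2 ^ ℓ * ∑ k, u k ^ 2 := by
  have h : Matrix.vecMul u (Had ℓ) ⬝ᵥ Matrix.vecMul u (Had ℓ) = 2 ^ ℓ * (u ⬝ᵥ u) := by
    rw [← Matrix.mulVec_transpose, Matrix.dotProduct_mulVec, Matrix.vecMul_transpose,
      Matrix.mulVec_mulVec, Had_mul_transpose,
      Matrix.smul_mulVec, Matrix.one_mulVec, smul_dotProduct, smul_eq_mul]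
  simpa [dotProduct, Matrix.vecMul, pow_two] using h

/-- The `(j, k)` entry of the transform of a vector given by its coordinates. -/
def hadForm (ℓ m : ℕ) (D : Fin m → Fin (2 ^ ℓ) → ℝ) (y : Fin (2 ^ ℓ) → ℝ)
    (j : Fin m) (k : Fin (2 ^ ℓ)) : ℝ :=
  ∑ i, Had ℓ k i * (D j i * y i)

lemma rht_eq_hadForm (ℓ m : ℕ) (D : Fin m → Fin (2 ^ ℓ) → ℝ)
    (z : EuclideanSpace ℝ (Fin (2 ^ ℓ))) (j : Fin m) (k : Fin (2 ^ ℓ)) :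
    rht ℓ m D z j k = hadForm ℓ m D (fun i => z i) j k := rfl

/-- Continuously differentiable, `1`-Lipschitz functions bounded by `B`. -/
structure IsTestFunction (f f' : ℝ → ℝ) (B : ℝ) : Prop where
  hasDerivAt : ∀ x, HasDerivAt f (f' x) x
  continuous_deriv : Continuous f'
  deriv_le : ∀ x, |f' x| ≤ 1
  bound : ∀ x, |f x| ≤ B

namespace IsTestFunction

variable {f f' : ℝ → ℝ} {B : ℝ}

lemma continuous (hf : IsTestFunction f f' B) : Continuous f :=
  continuous_iff_continuousAt.2 fun x => (hf.hasDerivAt x).continuousAt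

lemma abs_sub_le (hf : IsTestFunction f f' B) (x y : ℝ) : |f x - f y| ≤ |x - y| := by
  have := Convex.norm_image_sub_le_of_norm_hasDerivWithin_le (f := f) (f' := f') (C := 1)
    (s := Set.univ) (fun x _ => (hf.hasDerivAt x).hasDerivWithinAt)
    (fun x _ => hf.deriv_le x) convex_univ (Set.mem_univ y) (Set.mem_univ x)
  simpa using this

end IsTestFunction

/-- Gaussian smoothing with variance `v`. -/
def gsmooth (v : ℝ≥0) (f : ℝ → ℝ) (a : ℝ) : ℝ := ∫ t, f (a + t) ∂(gaussianReal 0 v)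

namespace IsTestFunction

variable {f f' : ℝ → ℝ} {B : ℝ}

protected lemma integrable (hf : IsTestFunction f f' B) (μ : Measure ℝ) [IsFiniteMeasure μ]
    (a : ℝ) : Integrable (fun t => f (a + t)) μ :=
  Integrable.of_bound (hf.continuous.comp (continuous_const.add continuous_id)).aestronglyMeasurable
    B (ae_of_all _ fun _ => hf.bound _)

protected lemma gsmooth (hf : IsTestFunction f f' B) (v : ℝ≥0) :
    IsTestFunction (gsmooth v f) (gsmooth v f') B where
  hasDerivAt x := by
    refine (hasDerivAt_integral_of_dominated_loc_of_deriv_le (F := fun x t => f (x + t))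
      (F' := fun x t => f' (x + t)) (bound := fun _ => 1) (s := Set.univ) Filter.univ_mem
      ?_ (hf.integrable _ x) ?_ ?_ (integrable_const _) ?_).2
    · exact Filter.Eventually.of_forall fun y => (hf.integrable _ y).aestronglyMeasurable
    · exact (hf.continuous_deriv.comp (continuous_const.add continuous_id)).aestronglyMeasurable
    · exact ae_of_all _ fun t y _ => hf.deriv_le _
    · exact ae_of_all _ fun t y _ => (hf.hasDerivAt (y + t)).comp_add_const y t
  continuous_deriv := by
    refine continuous_of_dominated (bound := fun _ => 1) (fun y => ?_)
      (fun y => ae_of_all _ fun t => hf.deriv_le _) (integrable_const _)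
      (ae_of_all _ fun t => hf.continuous_deriv.comp (continuous_id.add continuous_const))
    exact (hf.continuous_deriv.comp (continuous_const.add continuous_id)).aestronglyMeasurable
  deriv_le x := by
    refine (norm_integral_le_of_norm_le_const (f := fun t => f' (x + t))
      (ae_of_all _ fun t => hf.deriv_le (x + t))).trans ?_
    simp
  bound x := by
    refine (norm_integral_le_of_norm_le_const (f := fun t => f (x + t))
      (ae_of_all _ fun t => hf.bound (x + t))).trans ?_
    simp

lemma gsmooth_gsmooth (hf : IsTestFunction f f' B) (u v : ℝ≥0) :
    gsmooth u (_root_.gsmooth v f) = _root_.gsmooth (u + v) f := by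
  funext a
  have h := gaussianReal_conv_gaussianReal (m₁ := 0) (m₂ := 0) (v₁ := u) (v₂ := v)
  rw [add_zero] at h
  unfold _root_.gsmooth
  rw [← h, integral_conv (by rw [h]; exact hf.integrable _ a)]
  simp_rw [add_assoc]

end IsTestFunction

lemma gsmooth_zero (f : ℝ → ℝ) : gsmooth 0 f = f := by
  funext a
  simp [gsmooth, gaussianReal_zero_var]

/-- The law of a linear form of i.i.d. standard Gaussians. -/
lemma map_linear_pi_gaussianReal {ι : Type*} [Fintype ι] (c : ι → ℝ) :
    (Measure.pi fun _ : ι => gaussianReal 0 1).map (fun x => ∑ i, c i * x i)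
      = gaussianReal 0 (∑ i, c i ^ 2).toNNReal := by
  have hm : Measurable fun x : ι → ℝ => ∑ i, c i * x i := by fun_prop
  have : IsProbabilityMeasure ((Measure.pi fun _ : ι => gaussianReal 0 1).map
      (fun x => ∑ i, c i * x i)) := Measure.isProbabilityMeasure_map hm.aemeasurable
  refine Measure.ext_of_charFun ?_
  ext t
  rw [charFun_gaussianReal, charFun_apply_real, integral_map hm.aemeasurable (by fun_prop)]
  have h1 : ∀ x : ι → ℝ, Complex.exp (t * ((∑ i, c i * x i : ℝ) : ℂ) * Complex.I)
      = ∏ i, Complex.exp ((t * c i : ℝ) * (x i : ℂ) * Complex.I) := fun x => by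
    rw [← Complex.exp_sum]
    congr 1
    push_cast
    rw [Finset.mul_sum, Finset.sum_mul]
    exact Finset.sum_congr rfl fun i _ => by ring
  simp_rw [h1]
  rw [integral_fintype_prod_eq_prod (fun i (x : ℝ) =>
    Complex.exp ((t * c i : ℝ) * (x : ℂ) * Complex.I))]
  simp_rw [← charFun_apply_real, charFun_gaussianReal, ← Complex.exp_sum]
  congr 1
  have h0 : 0 ≤ ∑ i, c i ^ 2 := Finset.sum_nonneg fun i _ => sq_nonneg _
  rw [Real.coe_toNNReal _ h0]
  push_cast
  simp only [mul_zero, zero_mul, zero_sub, one_mul, Finset.sum_neg_distrib, Finset.sum_mul,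
    Finset.sum_div, mul_pow]
  congr 1
  exact Finset.sum_congr rfl fun i _ => by ring

lemma map_hadForm_diagMeasure (ℓ m : ℕ) (y : Fin (2 ^ ℓ) → ℝ) (j : Fin m) (k : Fin (2 ^ ℓ)) :
    (diagMeasure ℓ m).map (fun D => hadForm ℓ m D y j k)
      = gaussianReal 0 (∑ i, y i ^ 2).toNNReal := by
  have h1 : (fun D : Fin m → Fin (2 ^ ℓ) → ℝ => hadForm ℓ m D y j k)
      = (fun x : Fin (2 ^ ℓ) → ℝ => ∑ i, (Had ℓ k i * y i) * x i) ∘ Function.eval j := by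
    funext D
    simp only [hadForm, Function.comp, Function.eval]
    exact Finset.sum_congr rfl fun i _ => by ring
  rw [h1, ← Measure.map_map (by fun_prop) (by fun_prop)]
  have h2 := (measurePreserving_eval (fun _ : Fin m =>
    Measure.pi fun _ : Fin (2 ^ ℓ) => gaussianReal 0 1) j).map_eq
  unfold diagMeasure
  rw [h2, map_linear_pi_gaussianReal]
  simp_rw [mul_pow, Had_sq, one_mul]

/-- The average of `f` over all entries of the transform, shifted by `a`. -/
def shiftAvg (ℓ m : ℕ) (f : ℝ → ℝ) (a : Fin m → Fin (2 ^ ℓ) → ℝ) (y : Fin (2 ^ ℓ) → ℝ)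
    (D : Fin m → Fin (2 ^ ℓ) → ℝ) : ℝ :=
  ((m : ℝ) * 2 ^ ℓ)⁻¹ * ∑ j, ∑ k, f (a j k + hadForm ℓ m D y j k)

/-- `D ↦ hadForm ℓ m D y j k` as a continuous linear map. -/
def hadFormCLM (ℓ m : ℕ) (y : Fin (2 ^ ℓ) → ℝ) (j : Fin m) (k : Fin (2 ^ ℓ)) :
    (Fin m → Fin (2 ^ ℓ) → ℝ) →L[ℝ] ℝ :=
  ∑ i, (Had ℓ k i * y i) • (ContinuousLinearMap.proj (R := ℝ) (φ := fun _ : Fin (2 ^ ℓ) => ℝ) i ∘L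
    ContinuousLinearMap.proj (R := ℝ) (φ := fun _ : Fin m => Fin (2 ^ ℓ) → ℝ) j)

lemma hadFormCLM_apply (ℓ m : ℕ) (y : Fin (2 ^ ℓ) → ℝ) (j : Fin m) (k : Fin (2 ^ ℓ))
    (D : Fin m → Fin (2 ^ ℓ) → ℝ) : hadFormCLM ℓ m y j k D = hadForm ℓ m D y j k := by
  simp only [hadFormCLM, hadForm, sum_apply, smul_apply,
    ContinuousLinearMap.comp_apply, ContinuousLinearMap.proj_apply, smul_eq_mul]
  exact Finset.sum_congr rfl fun i _ => by ring

lemma continuous_hadForm (ℓ m : ℕ) (y : Fin (2 ^ ℓ) → ℝ) (j : Fin m) (k : Fin (2 ^ ℓ)) :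
    Continuous fun D => hadForm ℓ m D y j k := by
  unfold hadForm
  fun_prop

section

variable {f f' : ℝ → ℝ} {B : ℝ}

lemma abs_shiftAvg_le (ℓ m : ℕ) (hm : 0 < m) (hB : ∀ x, |f x| ≤ B) (a : Fin m → Fin (2 ^ ℓ) → ℝ)
    (y : Fin (2 ^ ℓ) → ℝ) (D : Fin m → Fin (2 ^ ℓ) → ℝ) : |shiftAvg ℓ m f a y D| ≤ B := by
  have hm' : (0 : ℝ) < m := by exact_mod_cast hm
  unfold shiftAvg
  rw [abs_mul, abs_of_nonneg (by positivity)]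
  calc ((m : ℝ) * 2 ^ ℓ)⁻¹ * |∑ j, ∑ k, f (a j k + hadForm ℓ m D y j k)|
      ≤ ((m : ℝ) * 2 ^ ℓ)⁻¹ * ∑ _j : Fin m, ∑ _k : Fin (2 ^ ℓ), B := by
        gcongr
        refine (Finset.abs_sum_le_sum_abs _ _).trans (Finset.sum_le_sum fun j _ => ?_)
        exact (Finset.abs_sum_le_sum_abs _ _).trans (Finset.sum_le_sum fun k _ => hB _)
    _ = B := by
        simp
        field_simp

lemma integral_shiftAvg (hf : IsTestFunction f f' B) (ℓ m : ℕ) (a : Fin m → Fin (2 ^ ℓ) → ℝ)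
    (y : Fin (2 ^ ℓ) → ℝ) :
    ∫ D, shiftAvg ℓ m f a y D ∂(diagMeasure ℓ m)
      = ((m : ℝ) * 2 ^ ℓ)⁻¹ * ∑ j, ∑ k, gsmooth (∑ i, y i ^ 2).toNNReal f (a j k) := by
  have hint : ∀ j k, Integrable (fun D => f (a j k + hadForm ℓ m D y j k)) (diagMeasure ℓ m) :=
    fun j k => Integrable.of_bound (hf.continuous.comp
      (continuous_const.add (continuous_hadForm ℓ m y j k))).aestronglyMeasurable B
      (ae_of_all _ fun _ => hf.bound _)
  unfold shiftAvg
  rw [integral_const_mul,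
    integral_finsetSum _ fun j _ => integrable_finsetSum _ fun k _ => hint j k]
  congr 1
  refine Finset.sum_congr rfl fun j _ => ?_
  rw [integral_finsetSum _ fun k _ => hint j k]
  refine Finset.sum_congr rfl fun k _ => ?_
  rw [gsmooth, ← map_hadForm_diagMeasure ℓ m y j k,
    integral_map (continuous_hadForm ℓ m y j k).aemeasurable
      (hf.integrable _ (a j k)).aestronglyMeasurable]

/-- The differential of `shiftAvg`. -/
def shiftAvgDeriv (ℓ m : ℕ) (f' : ℝ → ℝ) (a : Fin m → Fin (2 ^ ℓ) → ℝ) (y : Fin (2 ^ ℓ) → ℝ)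
    (D : Fin m → Fin (2 ^ ℓ) → ℝ) : (Fin m → Fin (2 ^ ℓ) → ℝ) →L[ℝ] ℝ :=
  ((m : ℝ) * 2 ^ ℓ)⁻¹ • ∑ j, ∑ k, f' (a j k + hadForm ℓ m D y j k) • hadFormCLM ℓ m y j k

lemma hasFDerivAt_shiftAvg (hf : IsTestFunction f f' B) (ℓ m : ℕ) (a : Fin m → Fin (2 ^ ℓ) → ℝ)
    (y : Fin (2 ^ ℓ) → ℝ) (D : Fin m → Fin (2 ^ ℓ) → ℝ) :
    HasFDerivAt (shiftAvg ℓ m f a y) (shiftAvgDeriv ℓ m f' a y D) D := by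
  unfold shiftAvg shiftAvgDeriv
  refine HasFDerivAt.const_mul (HasFDerivAt.fun_sum fun j _ => HasFDerivAt.fun_sum fun k _ => ?_) _
  have h1 : HasFDerivAt (fun D => a j k + hadForm ℓ m D y j k) (hadFormCLM ℓ m y j k) D := by
    simpa only [hadFormCLM_apply] using (hadFormCLM ℓ m y j k).hasFDerivAt.const_add (a j k)
  exact (hf.hasDerivAt _).comp_hasFDerivAt D h1

lemma shiftAvgDeriv_apply (ℓ m : ℕ) (a : Fin m → Fin (2 ^ ℓ) → ℝ)
    (y : Fin (2 ^ ℓ) → ℝ) (D Y : Fin m → Fin (2 ^ ℓ) → ℝ) :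
    shiftAvgDeriv ℓ m f' a y D Y = ∑ j, ∑ i, (((m : ℝ) * 2 ^ ℓ)⁻¹ *
      (y i * ∑ k, f' (a j k + hadForm ℓ m D y j k) * Had ℓ k i)) * Y j i := by
  simp only [shiftAvgDeriv, smul_apply, sum_apply,
    hadFormCLM_apply, smul_eq_mul]
  rw [Finset.mul_sum]
  refine Finset.sum_congr rfl fun j _ => ?_
  simp only [hadForm, Finset.mul_sum, Finset.sum_mul]
  rw [Finset.sum_comm]
  exact Finset.sum_congr rfl fun i _ => Finset.sum_congr rfl fun k _ => by ring

lemma lintegral_exp_shiftAvgDeriv_le (hf : IsTestFunction f f' B) (ℓ m : ℕ) (hm : 0 < m)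
    (a : Fin m → Fin (2 ^ ℓ) → ℝ) {y : Fin (2 ^ ℓ) → ℝ} {b : ℝ} (hy : ∀ i, y i ^ 2 ≤ b)
    (D : Fin m → Fin (2 ^ ℓ) → ℝ) (s : ℝ) :
    ∫⁻ Y, ENNReal.ofReal (exp (s * shiftAvgDeriv ℓ m f' a y D Y)) ∂(diagMeasure ℓ m)
      ≤ ENNReal.ofReal (exp (s ^ 2 * (b / m) / 2)) := by
  have hm' : (0 : ℝ) < m := by exact_mod_cast hm
  set w : Fin m → Fin (2 ^ ℓ) → ℝ := fun j i => s * (((m : ℝ) * 2 ^ ℓ)⁻¹ *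
      (y i * ∑ k, f' (a j k + hadForm ℓ m D y j k) * Had ℓ k i)) with hw
  have h1 : ∀ Y, s * shiftAvgDeriv ℓ m f' a y D Y = ∑ j, ∑ i, w j i * Y j i := fun Y => by
    rw [shiftAvgDeriv_apply]
    rw [Finset.mul_sum]
    refine Finset.sum_congr rfl fun j _ => ?_
    rw [Finset.mul_sum]
    exact Finset.sum_congr rfl fun i _ => (mul_assoc _ _ _).symm
  simp_rw [h1]
  rw [lintegral_exp_linear_diag]
  refine ENNReal.ofReal_le_ofReal (exp_le_exp.2 ?_)
  gcongr
  have hb : 0 ≤ b := (sq_nonneg _).trans (hy ⟨0, by positivity⟩)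
  calc ∑ j, ∑ i, w j i ^ 2
      ≤ ∑ j : Fin m, s ^ 2 * (((m : ℝ) * 2 ^ ℓ)⁻¹ ^ 2 * (b * (2 ^ ℓ * 2 ^ ℓ))) := by
        refine Finset.sum_le_sum fun j _ => ?_
        calc ∑ i, w j i ^ 2
            ≤ ∑ i, s ^ 2 * (((m : ℝ) * 2 ^ ℓ)⁻¹ ^ 2 * (b *
                (∑ k, f' (a j k + hadForm ℓ m D y j k) * Had ℓ k i) ^ 2)) := by
              refine Finset.sum_le_sum fun i _ => ?_
              simp only [hw, mul_pow]
              gcongr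
              exact hy i
          _ = s ^ 2 * (((m : ℝ) * 2 ^ ℓ)⁻¹ ^ 2 * (b *
                (2 ^ ℓ * ∑ k, f' (a j k + hadForm ℓ m D y j k) ^ 2))) := by
              rw [← Finset.mul_sum, ← Finset.mul_sum, ← Finset.mul_sum, sum_sq_vecMul_Had]
          _ ≤ _ := by
              gcongr
              calc ∑ k, f' (a j k + hadForm ℓ m D y j k) ^ 2 ≤ ∑ _k : Fin (2 ^ ℓ), (1 : ℝ) :=
                    Finset.sum_le_sum fun k _ => by
                      rw [← sq_abs]; exact pow_le_one₀ (abs_nonneg _) (hf.deriv_le _)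
                _ = _ := by simp
    _ = s ^ 2 * (b / m) := by
        simp
        field_simp

/-- Concentration of the shifted average; only the largest coordinate of `y` matters. -/
theorem measureReal_abs_shiftAvg_sub_le (hf : IsTestFunction f f' B) (ℓ m : ℕ) (hm : 0 < m)
    (a : Fin m → Fin (2 ^ ℓ) → ℝ) {y : Fin (2 ^ ℓ) → ℝ} {b : ℝ} (hy : ∀ i, y i ^ 2 ≤ b)
    {t : ℝ} (ht : 0 ≤ t) :
    (diagMeasure ℓ m).real {D | t ≤ |shiftAvg ℓ m f a y D -
        ((m : ℝ) * 2 ^ ℓ)⁻¹ * ∑ j, ∑ k, gsmooth (∑ i, y i ^ 2).toNNReal f (a j k)|}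
      ≤ 2 * exp (-t ^ 2 / (π ^ 2 * (b / m) / 2)) := by
  have hb : 0 ≤ b := (sq_nonneg _).trans (hy ⟨0, by positivity⟩)
  have key : ∀ {g g' : ℝ → ℝ}, IsTestFunction g g' B → (diagMeasure ℓ m).real
      {D | t ≤ shiftAvg ℓ m g a y D - ∫ D', shiftAvg ℓ m g a y D' ∂(diagMeasure ℓ m)}
      ≤ exp (-t ^ 2 / (π ^ 2 * (b / m) / 2)) := by
    intro g g' hg
    refine measureReal_sub_integral_ge_le (diagMeasure ℓ m) (measurePreserving_rotation_diag ℓ m)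
      (hasFDerivAt_shiftAvg hg ℓ m a y) ?_ (by positivity)
      (lintegral_exp_shiftAvgDeriv_le hg ℓ m hm a hy) (abs_shiftAvg_le ℓ m hm hg.bound a y) ht
    have := continuous_hadForm ℓ m y
    have := hg.continuous_deriv
    unfold shiftAvgDeriv
    fun_prop
  have hneg : IsTestFunction (fun x => -f x) (fun x => -f' x) B :=
    ⟨fun x => (hf.hasDerivAt x).neg, hf.continuous_deriv.neg, fun x => by
      simpa using hf.deriv_le x, fun x => by simpa using hf.bound x⟩
  have hs : ∀ D, shiftAvg ℓ m (fun x => -f x) a y D = -shiftAvg ℓ m f a y D := fun D => by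
    simp [shiftAvg]
  have h1 := key hf
  have h2 := key hneg
  simp only [hs, integral_neg] at h2
  rw [integral_shiftAvg hf] at h1 h2
  refine (measureReal_mono (fun D hD => ?_) (by finiteness)).trans
    ((measureReal_union_le _ _).trans ((add_le_add h1 h2).trans_eq (by ring)))
  rcases le_abs.1 (Set.mem_ofPred_eq ▸ hD) with h | h
  · exact Or.inl h
  · exact Or.inr (by simp only [Set.mem_ofPred_eq]; linarith)

end

/-- The average of `f` over the entries of the transform of `z`. -/
def coordAvg (ℓ m : ℕ) (f : ℝ → ℝ) (z : Fin (2 ^ ℓ) → ℝ) (D : Fin m → Fin (2 ^ ℓ) → ℝ) : ℝ :=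
  ((m : ℝ) * 2 ^ ℓ)⁻¹ * ∑ j, ∑ k, f (hadForm ℓ m D z j k)

lemma continuous_coordAvg (ℓ m : ℕ) {f : ℝ → ℝ} (hf : Continuous f) (z : Fin (2 ^ ℓ) → ℝ) :
    Continuous (coordAvg ℓ m f z) := by
  have := continuous_hadForm ℓ m z
  unfold coordAvg
  fun_prop

lemma hadForm_add_of_mix (ℓ m : ℕ) (S : Finset (Fin (2 ^ ℓ))) {v y : Fin (2 ^ ℓ) → ℝ}
    (hv : ∀ i ∉ S, v i = 0) (hy : ∀ i ∈ S, y i = 0) (D D' : Fin m → Fin (2 ^ ℓ) → ℝ)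
    (j : Fin m) (k : Fin (2 ^ ℓ)) :
    hadForm ℓ m (fun j i => if i ∈ S then D j i else D' j i) (v + y) j k
      = hadForm ℓ m D v j k + hadForm ℓ m D' y j k := by
  simp only [hadForm, ← Finset.sum_add_distrib]
  refine Finset.sum_congr rfl fun i _ => ?_
  by_cases hi : i ∈ S
  · simp [hi, hy i hi]
  · simp [hi, hv i hi]

lemma hadForm_of_mix (ℓ m : ℕ) (S : Finset (Fin (2 ^ ℓ))) {v : Fin (2 ^ ℓ) → ℝ}
    (hv : ∀ i ∉ S, v i = 0) (D D' : Fin m → Fin (2 ^ ℓ) → ℝ)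
    (j : Fin m) (k : Fin (2 ^ ℓ)) :
    hadForm ℓ m (fun j i => if i ∈ S then D j i else D' j i) v j k = hadForm ℓ m D v j k := by
  have := hadForm_add_of_mix ℓ m S (y := 0) hv (fun _ _ => rfl) D D' j k
  simpa [hadForm] using this

/-- Replacing the part `y` of `v + y` by an independent Gaussian of the same variance changes
the average of `f` only slightly, when the entries of `y` are small. -/
theorem measure_coordAvg_add_sub_le {f f' : ℝ → ℝ} {B : ℝ} (hf : IsTestFunction f f' B)
    (ℓ m : ℕ) (hm : 0 < m) (S : Finset (Fin (2 ^ ℓ))) {v y : Fin (2 ^ ℓ) → ℝ}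
    (hv : ∀ i ∉ S, v i = 0) (hy : ∀ i ∈ S, y i = 0) {b : ℝ} (hb : ∀ i, y i ^ 2 ≤ b)
    {t : ℝ} (ht : 0 ≤ t) :
    diagMeasure ℓ m {D | t ≤ |coordAvg ℓ m f (v + y) D -
        coordAvg ℓ m (gsmooth (∑ i, y i ^ 2).toNNReal f) v D|}
      ≤ ENNReal.ofReal (2 * exp (-t ^ 2 / (π ^ 2 * (b / m) / 2))) := by
  have hc1 := continuous_coordAvg ℓ m hf.continuous (v + y)
  have hc2 := continuous_coordAvg ℓ m (hf.gsmooth (∑ i, y i ^ 2).toNNReal).continuous v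
  have hA : MeasurableSet {D | t ≤ |coordAvg ℓ m f (v + y) D -
        coordAvg ℓ m (gsmooth (∑ i, y i ^ 2).toNNReal f) v D|} :=
    (isClosed_le continuous_const (hc1.sub hc2).abs).measurableSet
  have hmp := measurePreserving_resample ℓ m S
  rw [← hmp.measure_preimage hA.nullMeasurableSet, Measure.prod_apply (hmp.measurable hA)]
  calc _ ≤ ∫⁻ _, ENNReal.ofReal (2 * exp (-t ^ 2 / (π ^ 2 * (b / m) / 2))) ∂(diagMeasure ℓ m) := by
        refine lintegral_mono fun D => ?_
        have h := measureReal_abs_shiftAvg_sub_le hf ℓ m hm (fun j k => hadForm ℓ m D v j k) hb ht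
        rw [← ofReal_measureReal]
        refine ENNReal.ofReal_le_ofReal (le_of_eq_of_le ?_ h)
        congr 1
        ext D'
        simp only [Set.mem_preimage, Set.mem_ofPred_eq, coordAvg, shiftAvg,
          hadForm_add_of_mix ℓ m S hv hy, hadForm_of_mix ℓ m S hv]
    _ = _ := by simp

/-- The vector with the entries prescribed by a list of (position, shifted value) pairs. -/
def decodeSparse {d M K : ℕ} (p : Fin K → Fin d × Fin (2 * M + 1)) (i : Fin d) : ℤ :=
  if h : ∃ a, (p a).1 = i then ((p h.choose).2 : ℤ) - M else 0

lemma exists_decodeSparse {d M K : ℕ} [NeZero d] (u : Fin d → ℤ) (hu : ∀ i, |u i| ≤ M)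
    (hK : (Finset.univ.filter fun i => u i ≠ 0).card ≤ K) :
    ∃ p : Fin K → Fin d × Fin (2 * M + 1), decodeSparse p = u := by
  set S := Finset.univ.filter fun i => u i ≠ 0 with hS
  let e : Fin K → Fin d := fun a => if h : a.1 < S.card then (S.equivFin.symm ⟨a, h⟩ : S).1 else 0
  have he : ∀ i ∈ S, ∃ a, e a = i := fun i hi => by
    refine ⟨⟨S.equivFin ⟨i, hi⟩, (Fin.is_lt _).trans_le hK⟩, ?_⟩
    simp [e]
  refine ⟨fun a => (e a, ⟨(u (e a) + M).toNat, ?_⟩), ?_⟩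
  · have := abs_le.1 (hu (e a))
    lia
  · funext i
    unfold decodeSparse
    split_ifs with h
    · have h1 := h.choose_spec
      simp only at h1 ⊢
      rw [h1]
      have := abs_le.1 (hu i)
      lia
    · by_contra hne
      exact h (he i (by simp [hS, Ne.symm hne]))

/-- Keep the entries of absolute value larger than `2 ^ P / 2 ^ s`. -/
def truncLarge {d : ℕ} (P s : ℕ) (w : Fin d → ℤ) (i : Fin d) : ℤ :=
  if 2 ^ P < 2 ^ s * |w i| then w i else 0

lemma truncLarge_truncLarge_succ {d : ℕ} (P s : ℕ) (w : Fin d → ℤ) :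
    truncLarge P s (truncLarge P (s + 1) w) = truncLarge P s w := by
  funext i
  have h : (2 : ℤ) ^ s * |w i| ≤ 2 ^ (s + 1) * |w i| := by
    gcongr <;> simp
  have h0 : (0 : ℤ) ≤ 2 ^ P := by positivity
  unfold truncLarge
  split_ifs <;> simp_all <;> lia

lemma truncLarge_zero {d : ℕ} (P : ℕ) {w : Fin d → ℤ} (hw : ∀ i, |w i| ≤ 2 ^ P) :
    truncLarge P 0 w = 0 := by
  funext i
  simp [truncLarge, (hw i).not_gt]

lemma truncLarge_last {d : ℕ} (P : ℕ) (w : Fin d → ℤ) : truncLarge P (P + 1) w = w := by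
  funext i
  unfold truncLarge
  split_ifs with h
  · rfl
  · by_contra hne
    apply h
    have : 1 ≤ |w i| := Int.one_le_abs (Ne.symm hne)
    have h2 : (0 : ℤ) < 2 ^ P := by positivity
    rw [pow_succ]
    nlinarith

lemma abs_truncLarge_le {d : ℕ} (P s : ℕ) (w : Fin d → ℤ) (i : Fin d) :
    |truncLarge P s w i| ≤ |w i| := by
  unfold truncLarge
  split_ifs <;> simp

lemma sum_sq_truncLarge_le {d : ℕ} (P s : ℕ) (w : Fin d → ℤ) :
    ∑ i, truncLarge P s w i ^ 2 ≤ ∑ i, w i ^ 2 :=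
  Finset.sum_le_sum fun i _ => sq_le_sq.2 (abs_truncLarge_le P s w i)

lemma card_truncLarge_ne_zero_le {d : ℕ} (P s : ℕ) {w : Fin d → ℤ}
    (hw : ∑ i, w i ^ 2 ≤ (2 ^ P) ^ 2) :
    (Finset.univ.filter fun i => truncLarge P s w i ≠ 0).card ≤ 4 ^ s := by
  set S := Finset.univ.filter fun i => truncLarge P s w i ≠ 0 with hS
  have h1 : ∀ i ∈ S, (2 ^ P : ℤ) ^ 2 ≤ 4 ^ s * w i ^ 2 := fun i hi => by
    have hi' : 2 ^ P < 2 ^ s * |w i| := by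
      by_contra h
      simp [hS, truncLarge, h] at hi
    have : (4 : ℤ) ^ s * w i ^ 2 = (2 ^ s * |w i|) ^ 2 := by
      rw [mul_pow, sq_abs, ← pow_mul, mul_comm s, pow_mul]; norm_num
    rw [this]
    gcongr
  have h2 : (S.card : ℤ) * (2 ^ P) ^ 2 ≤ 4 ^ s * (2 ^ P) ^ 2 :=
    calc (S.card : ℤ) * (2 ^ P) ^ 2 = ∑ _i ∈ S, (2 ^ P : ℤ) ^ 2 := by simp
      _ ≤ ∑ i ∈ S, 4 ^ s * w i ^ 2 := Finset.sum_le_sum h1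
      _ ≤ ∑ i, 4 ^ s * w i ^ 2 :=
        Finset.sum_le_sum_of_subset_of_nonneg (Finset.subset_univ _) fun _ _ _ => by positivity
      _ ≤ _ := by rw [← Finset.mul_sum]; gcongr
  exact_mod_cast le_of_mul_le_mul_right h2 (by positivity)

/-- The event that, at scale `s`, integrating out the small entries of `u` changes the average. -/
def levelEvent (ℓ m : ℕ) (f : ℝ → ℝ) (P s : ℕ) (t : ℝ) (T : ℕ) (u : Fin (2 ^ ℓ) → ℤ) :
    Set (Fin m → Fin (2 ^ ℓ) → ℝ) :=
  {D | t ≤ |coordAvg ℓ m (gsmooth (T / (2 ^ P) ^ 2) f) (fun i => (u i : ℝ) / 2 ^ P) D -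
    coordAvg ℓ m (gsmooth ((∑ i, (((u i : ℝ) - truncLarge P s u i) / 2 ^ P) ^ 2).toNNReal
      + T / (2 ^ P) ^ 2) f) (fun i => (truncLarge P s u i : ℝ) / 2 ^ P) D|}

lemma measure_levelEvent_le {f f' : ℝ → ℝ} {B : ℝ} (hf : IsTestFunction f f' B)
    (ℓ m : ℕ) (hm : 0 < m) (P s : ℕ) {t : ℝ} (ht : 0 ≤ t) (T : ℕ) (u : Fin (2 ^ ℓ) → ℤ) :
    diagMeasure ℓ m (levelEvent ℓ m f P s t T u)
      ≤ ENNReal.ofReal (2 * exp (-(2 * t ^ 2 * m / π ^ 2) * 4 ^ s)) := by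
  have hm' : (0 : ℝ) < m := by exact_mod_cast hm
  have h := measure_coordAvg_add_sub_le (hf.gsmooth (T / (2 ^ P) ^ 2)) ℓ m hm
    (Finset.univ.filter fun i => 2 ^ P < 2 ^ s * |u i|)
    (v := fun i => (truncLarge P s u i : ℝ) / 2 ^ P)
    (y := fun i => ((u i : ℝ) - truncLarge P s u i) / 2 ^ P) (b := (4 ^ s)⁻¹)
    (fun i hi => by
      have : ¬ 2 ^ P < 2 ^ s * |u i| := by simpa using hi
      simp [truncLarge, this])
    (fun i hi => by
      have : 2 ^ P < 2 ^ s * |u i| := by simpa using hi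
      simp [truncLarge, this])
    (fun i => by
      unfold truncLarge
      split_ifs with h
      · simp
      · have h1 : (2 : ℝ) ^ s * |(u i : ℝ)| ≤ 2 ^ P := by exact_mod_cast not_lt.1 h
        have h2 : ((2 : ℝ) ^ s * |(u i : ℝ)|) ^ 2 ≤ (2 ^ P) ^ 2 := by gcongr
        rw [mul_pow, sq_abs, ← pow_mul, mul_comm s, pow_mul] at h2
        norm_num at h2
        rw [Int.cast_zero, sub_zero, div_pow, div_le_iff₀ (by positivity), inv_mul_eq_div,
          le_div_iff₀ (by positivity), mul_comm]
        exact h2) ht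
  rw [hf.gsmooth_gsmooth] at h
  refine (le_of_eq ?_).trans (h.trans (ENNReal.ofReal_le_ofReal (le_of_eq ?_)))
  · unfold levelEvent
    congr 1
    ext D
    have hz : (fun i => (truncLarge P s u i : ℝ) / 2 ^ P) +
        (fun i => ((u i : ℝ) - truncLarge P s u i) / 2 ^ P) = fun i => (u i : ℝ) / 2 ^ P := by
      funext i
      simp only [Pi.add_apply]
      ring
    rw [hz]
  · congr 2
    field_simp

lemma natCast_mul_ofReal (n : ℕ) (x : ℝ) :
    (n : ℝ≥0∞) * ENNReal.ofReal x = ENNReal.ofReal (n * x) := by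
  rw [ENNReal.ofReal_mul (Nat.cast_nonneg n), ENNReal.ofReal_natCast]

lemma abs_coordAvg_grid_sub_lt {f : ℝ → ℝ} (ℓ m : ℕ) (hm : 0 < m) (P : ℕ)
    {t : ℝ} {D : Fin m → Fin (2 ^ ℓ) → ℝ}
    (hD : ∀ s < P + 1, ∀ T : ℕ, T ≤ (2 ^ P) ^ 2 → ∀ u : Fin (2 ^ ℓ) → ℤ,
      (∀ i, |u i| ≤ 2 ^ P) → (Finset.univ.filter fun i => u i ≠ 0).card ≤ 4 ^ (s + 1) →
      D ∉ levelEvent ℓ m f P s t T u)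
    {w : Fin (2 ^ ℓ) → ℤ} (hw : ∑ i, w i ^ 2 ≤ (2 ^ P) ^ 2) :
    |coordAvg ℓ m f (fun i => (w i : ℝ) / 2 ^ P) D -
      gsmooth (∑ i, ((w i : ℝ) / 2 ^ P) ^ 2).toNNReal f 0| < (P + 1) * t := by
  have hwi : ∀ i, |w i| ≤ 2 ^ P := fun i => by
    refine abs_le_of_sq_le_sq ?_ (by positivity)
    exact (Finset.single_le_sum (f := fun i => w i ^ 2) (fun _ _ => sq_nonneg _)
      (Finset.mem_univ i)).trans hw
  let T : ℕ → ℕ := fun s => (∑ i, w i ^ 2 - ∑ i, truncLarge P s w i ^ 2).toNat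
  have hT : ∀ s, (T s : ℤ) = ∑ i, w i ^ 2 - ∑ i, truncLarge P s w i ^ 2 := fun s =>
    Int.toNat_of_nonneg (sub_nonneg.2 (sum_sq_truncLarge_le P s w))
  let F : ℕ → ℝ := fun s => coordAvg ℓ m (gsmooth (T s / (2 ^ P) ^ 2) f)
    (fun i => (truncLarge P s w i : ℝ) / 2 ^ P) D
  have hstep : ∀ s < P + 1, |F (s + 1) - F s| < t := fun s hs => by
    have h := hD s hs (T (s + 1)) (by
        have h1 := hT (s + 1)
        have h2 : (0 : ℤ) ≤ ∑ i, truncLarge P (s + 1) w i ^ 2 := by positivity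
        zify
        linarith)
      (truncLarge P (s + 1) w) (fun i => (abs_truncLarge_le P (s + 1) w i).trans (hwi i))
      (card_truncLarge_ne_zero_le P (s + 1) hw)
    simp only [levelEvent, Set.mem_ofPred_eq, not_le, truncLarge_truncLarge_succ] at h
    refine lt_of_eq_of_lt ?_ h
    congr 2
    simp only [F]
    congr 1
    have hsum : ∑ i, (((truncLarge P (s + 1) w i : ℤ) : ℝ) - truncLarge P s w i) ^ 2
        = T s - T (s + 1) := by
      have h3 : ∑ i, (truncLarge P (s + 1) w i - truncLarge P s w i) ^ 2
          = (T s : ℤ) - T (s + 1) := by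
        rw [hT, hT, sub_sub_sub_cancel_left, ← Finset.sum_sub_distrib]
        refine Finset.sum_congr rfl fun i _ => ?_
        have h4 := congrFun (truncLarge_truncLarge_succ P s w) i
        rw [← h4]
        simp only [truncLarge]
        split_ifs <;> simp
      exact_mod_cast h3
    congr 1
    apply NNReal.coe_injective
    have h5 : (0 : ℝ) ≤ ∑ i, ((((truncLarge P (s + 1) w i : ℤ) : ℝ) - truncLarge P s w i)
      / 2 ^ P) ^ 2 := by positivity
    push_cast
    rw [Real.coe_toNNReal _ h5]
    simp_rw [div_pow]
    rw [← Finset.sum_div, hsum]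
    ring
  have hlast : F (P + 1) = coordAvg ℓ m f (fun i => (w i : ℝ) / 2 ^ P) D := by
    simp [F, T, truncLarge_last, gsmooth_zero]
  have hfirst : F 0 = gsmooth (∑ i, ((w i : ℝ) / 2 ^ P) ^ 2).toNNReal f 0 := by
    have hv : ((T 0 : ℝ≥0) / (2 ^ P) ^ 2) = (∑ i, ((w i : ℝ) / 2 ^ P) ^ 2).toNNReal := by
      apply NNReal.coe_injective
      rw [Real.coe_toNNReal _ (by positivity)]
      simp_rw [div_pow]
      rw [← Finset.sum_div]
      push_cast
      congr 1
      have h0 := hT 0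
      simp only [truncLarge_zero P hwi, Pi.zero_apply] at h0
      norm_num at h0
      exact_mod_cast h0
    have hm' : (0 : ℝ) < m := by exact_mod_cast hm
    simp only [F, truncLarge_zero P hwi, hv]
    simp [coordAvg, hadForm]
    field_simp
  rw [← hlast, ← hfirst, ← Finset.sum_range_sub]
  calc |∑ s ∈ Finset.range (P + 1), (F (s + 1) - F s)|
      ≤ ∑ s ∈ Finset.range (P + 1), |F (s + 1) - F s| := Finset.abs_sum_le_sum_abs _ _
    _ < ∑ _s ∈ Finset.range (P + 1), t :=
        Finset.sum_lt_sum_of_nonempty (by simp) fun s hs => hstep s (Finset.mem_range.1 hs)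
    _ = _ := by simp

/-- The union of the level events over all scales and all sparse grid vectors. -/
def gridBad (ℓ m : ℕ) (f : ℝ → ℝ) (P : ℕ) (t : ℝ) : Set (Fin m → Fin (2 ^ ℓ) → ℝ) :=
  ⋃ s ∈ Finset.range (P + 1), ⋃ p : Fin (4 ^ (s + 1)) → Fin (2 ^ ℓ) × Fin (2 * 2 ^ P + 1),
    ⋃ T : Fin ((2 ^ P) ^ 2 + 1), levelEvent ℓ m f P s t T (decodeSparse p)

lemma abs_coordAvg_grid_sub_lt_of_notMem {f : ℝ → ℝ} (ℓ m : ℕ) (hm : 0 < m) (P : ℕ)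
    {t : ℝ} {D : Fin m → Fin (2 ^ ℓ) → ℝ}
    (hD : D ∉ gridBad ℓ m f P t)
    {w : Fin (2 ^ ℓ) → ℤ} (hw : ∑ i, w i ^ 2 ≤ (2 ^ P) ^ 2) :
    |coordAvg ℓ m f (fun i => (w i : ℝ) / 2 ^ P) D -
      gsmooth (∑ i, ((w i : ℝ) / 2 ^ P) ^ 2).toNNReal f 0| < (P + 1) * t := by
  refine abs_coordAvg_grid_sub_lt ℓ m hm P (fun s hs T hT u hu hcard hmem => hD ?_) hw
  obtain ⟨p, rfl⟩ := exists_decodeSparse (M := 2 ^ P) u (by simpa using hu) hcard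
  simp only [gridBad, Set.mem_iUnion]
  exact ⟨s, Finset.mem_range.2 hs, p, ⟨T, Nat.lt_succ_of_le hT⟩, hmem⟩

lemma measure_gridBad_le {f f' : ℝ → ℝ} {B : ℝ} (hf : IsTestFunction f f' B)
    (ℓ m : ℕ) (hm : 0 < m) (P : ℕ) {t : ℝ} (ht : 0 ≤ t) {lam : ℝ} (hlam : 0 ≤ lam)
    (h : 6 * Real.log (2 ^ ℓ * (2 * 2 ^ P + 1)) + lam ≤ 2 * t ^ 2 * m / π ^ 2) :
    diagMeasure ℓ m (gridBad ℓ m f P t) ≤ ENNReal.ofReal ((P + 1) * (2 * exp (-lam))) := by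
  set K : ℝ := 2 ^ ℓ * (2 * 2 ^ P + 1) with hK
  have hK1 : 1 ≤ K := by
    have h1 : (1 : ℝ) ≤ 2 ^ ℓ := one_le_pow₀ (by norm_num)
    have h2 : (1 : ℝ) ≤ 2 ^ P := one_le_pow₀ (by norm_num)
    nlinarith
  have hK2 : ((2 ^ P : ℝ) ^ 2 + 1) ≤ K ^ 2 := by
    have h1 : (1 : ℝ) ≤ 2 ^ ℓ := one_le_pow₀ (by norm_num)
    have h2 : (1 : ℝ) ≤ 2 ^ P := one_le_pow₀ (by norm_num)
    have h3 : (2 * 2 ^ P + 1 : ℝ) ≤ K := by rw [hK]; nlinarith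
    nlinarith
  have hlevel : ∀ s, diagMeasure ℓ m
      (⋃ p : Fin (4 ^ (s + 1)) → Fin (2 ^ ℓ) × Fin (2 * 2 ^ P + 1),
        ⋃ T : Fin ((2 ^ P) ^ 2 + 1), levelEvent ℓ m f P s t T (decodeSparse p))
      ≤ ENNReal.ofReal (2 * exp (-lam)) := fun s => by
    calc _ ≤ ∑ _p : Fin (4 ^ (s + 1)) → Fin (2 ^ ℓ) × Fin (2 * 2 ^ P + 1),
          ∑ _T : Fin ((2 ^ P) ^ 2 + 1),
            ENNReal.ofReal (2 * exp (-(2 * t ^ 2 * m / π ^ 2) * 4 ^ s)) :=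
          (measure_iUnion_fintype_le _ _).trans (Finset.sum_le_sum fun p _ =>
            (measure_iUnion_fintype_le _ _).trans (Finset.sum_le_sum fun T _ =>
              measure_levelEvent_le hf ℓ m hm P s ht T _))
      _ = ENNReal.ofReal (K ^ (4 ^ (s + 1)) * (((2 ^ P) ^ 2 + 1) *
            (2 * exp (-(2 * t ^ 2 * m / π ^ 2) * 4 ^ s)))) := by
          simp only [Finset.sum_const, Finset.card_univ, Fintype.card_pi, Fintype.card_prod,
            Fintype.card_fin, Finset.prod_const, nsmul_eq_mul, natCast_mul_ofReal]
          push_cast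
          rfl
      _ ≤ _ := by
          refine ENNReal.ofReal_le_ofReal ?_
          have h4 : (1 : ℝ) ≤ 4 ^ s := one_le_pow₀ (by norm_num)
          have h5 : K ^ (4 ^ (s + 1)) * ((2 ^ P) ^ 2 + 1) ≤ exp (6 * Real.log K * 4 ^ s) := by
            calc K ^ (4 ^ (s + 1)) * ((2 ^ P) ^ 2 + 1) ≤ K ^ (4 ^ (s + 1)) * K ^ 2 := by gcongr
              _ = K ^ (4 ^ (s + 1) + 2) := (pow_add _ _ _).symm
              _ ≤ K ^ (6 * 4 ^ s) := by
                  refine pow_le_pow_right₀ hK1 ?_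
                  have : 1 ≤ 4 ^ s := Nat.one_le_pow _ _ (by norm_num)
                  rw [pow_succ]
                  lia
              _ = exp (6 * Real.log K * 4 ^ s) := by
                  rw [← Real.exp_log (pow_pos (by linarith) _ : (0 : ℝ) < K ^ (6 * 4 ^ s)),
                    Real.log_pow]
                  push_cast
                  ring_nf
          calc _ = (K ^ (4 ^ (s + 1)) * ((2 ^ P) ^ 2 + 1)) *
                (2 * exp (-(2 * t ^ 2 * m / π ^ 2) * 4 ^ s)) := by ring
            _ ≤ exp (6 * Real.log K * 4 ^ s) *
                (2 * exp (-(2 * t ^ 2 * m / π ^ 2) * 4 ^ s)) := by gcongr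
            _ = 2 * exp (6 * Real.log K * 4 ^ s + -(2 * t ^ 2 * m / π ^ 2) * 4 ^ s) := by
                rw [exp_add]; ring
            _ ≤ _ := by
                gcongr
                nlinarith
  calc diagMeasure ℓ m (gridBad ℓ m f P t)
      ≤ ∑ _s ∈ Finset.range (P + 1), ENNReal.ofReal (2 * exp (-lam)) :=
        (measure_biUnion_finset_le _ _).trans (Finset.sum_le_sum fun s _ => hlevel s)
    _ = _ := by
        simp only [Finset.sum_const, Finset.card_range, nsmul_eq_mul, natCast_mul_ofReal]
        push_cast
        rfl

lemma integral_exp_mul_gaussianReal (s : ℝ) :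
    ∫ x, exp (s * x) ∂(gaussianReal 0 1) = exp (s ^ 2 / 2) := by
  have h := mgf_gaussianReal (p := gaussianReal 0 1) (X := fun x => x) (μ := 0) (v := 1)
    Measure.map_id' s
  simpa [mgf] using h

lemma integrable_exp_abs_gaussianReal :
    Integrable (fun x => exp |x|) (gaussianReal 0 1) := by
  simpa using integrable_exp_mul_abs (X := fun x : ℝ => x) (t := 1)
    (integrable_exp_mul_gaussianReal 1) (integrable_exp_mul_gaussianReal (-1))

lemma integral_exp_abs_gaussianReal_le : ∫ x, exp |x| ∂(gaussianReal 0 1) ≤ exp 2 := by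
  calc ∫ x, exp |x| ∂(gaussianReal 0 1)
      ≤ ∫ x, (exp (1 * x) + exp (-1 * x)) ∂(gaussianReal 0 1) := by
        refine integral_mono integrable_exp_abs_gaussianReal
          ((integrable_exp_mul_gaussianReal 1).add (integrable_exp_mul_gaussianReal (-1)))
          fun x => ?_
        have := exp_pos x
        have := exp_pos (-x)
        rcases abs_cases x with ⟨h, _⟩ | ⟨h, _⟩ <;> simp [h] <;> positivity
    _ = 2 * exp (1 / 2) := by
        rw [integral_add (integrable_exp_mul_gaussianReal 1) (integrable_exp_mul_gaussianReal (-1)),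
          integral_exp_mul_gaussianReal, integral_exp_mul_gaussianReal]
        norm_num
        ring
    _ ≤ exp 1 * exp 1 := by
        have h1 : (2 : ℝ) ≤ exp 1 := by have := add_one_le_exp (1 : ℝ); linarith
        have h2 : exp (1 / 2) ≤ exp (1 : ℝ) := exp_le_exp.2 (by norm_num)
        gcongr
    _ = exp 2 := by rw [← exp_add]; norm_num

/-- The entries of the diagonals are of bounded size on average. -/
lemma measure_sum_abs_diag_le (ℓ m : ℕ) :
    diagMeasure ℓ m {D | 4 * ((m : ℝ) * 2 ^ ℓ) ≤ ∑ j, ∑ i, |D j i|}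
      ≤ ENNReal.ofReal (exp (-(2 * (m * 2 ^ ℓ)))) := by
  set N : ℝ := (m : ℝ) * 2 ^ ℓ with hN
  have h1 := mul_meas_ge_le_integral_of_nonneg (μ := diagMeasure ℓ m)
    (f := fun D => ∏ j, ∏ i, exp |D j i|) (ae_of_all _ fun D => by positivity)
    (integrable_prod_diag ℓ m (fun _ _ x => exp |x|) fun _ _ => integrable_exp_abs_gaussianReal)
    (exp (4 * N))
  rw [integral_prod_diag ℓ m (fun _ _ x => exp |x|)] at h1
  have h2 : ∏ _j : Fin m, ∏ _i : Fin (2 ^ ℓ), ∫ x, exp |x| ∂(gaussianReal 0 1) ≤ exp (2 * N) := by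
    have h0 : 0 ≤ ∫ x, exp |x| ∂(gaussianReal 0 1) := integral_nonneg fun _ => (exp_pos _).le
    calc _ ≤ ∏ _j : Fin m, ∏ _i : Fin (2 ^ ℓ), exp 2 := by
          gcongr with j _ i _
          exact integral_exp_abs_gaussianReal_le
      _ = _ := by
          simp only [Finset.prod_const, Finset.card_univ, Fintype.card_fin, ← exp_nat_mul]
          congr 1
          rw [hN]
          push_cast
          ring
  have hset : {D : Fin m → Fin (2 ^ ℓ) → ℝ | 4 * N ≤ ∑ j, ∑ i, |D j i|}
      = {D | exp (4 * N) ≤ ∏ j, ∏ i, exp |D j i|} := by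
    ext D
    simp only [Set.mem_ofPred_eq, ← exp_sum, exp_le_exp]
  rw [hset, ← ofReal_measureReal]
  refine ENNReal.ofReal_le_ofReal ?_
  have h3 := h1.trans h2
  rw [mul_comm, ← le_div_iff₀ (exp_pos _), ← exp_sub] at h3
  exact h3.trans_eq (congrArg exp (by ring))

lemma exists_int_abs_le_abs_sub_le_one (x : ℝ) : ∃ w : ℤ, |(w : ℝ)| ≤ |x| ∧ |x - w| ≤ 1 := by
  rcases le_total 0 x with h | h
  · refine ⟨⌊x⌋, ?_, ?_⟩
    · have : (0 : ℝ) ≤ ⌊x⌋ := by exact_mod_cast Int.floor_nonneg.2 h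
      rw [abs_of_nonneg this, abs_of_nonneg h]
      exact Int.floor_le x
    · rw [abs_le]
      constructor <;> linarith [Int.floor_le x, Int.lt_floor_add_one x]
  · refine ⟨⌈x⌉, ?_, ?_⟩
    · have : (⌈x⌉ : ℝ) ≤ 0 := by exact_mod_cast Int.ceil_le.2 (by simpa using h)
      rw [abs_of_nonpos this, abs_of_nonpos h]
      linarith [Int.le_ceil x]
    · rw [abs_le]
      constructor <;> linarith [Int.le_ceil x, Int.ceil_lt_add_one x]

lemma integrable_abs_gaussianReal (v : ℝ≥0) : Integrable (fun x => |x|) (gaussianReal 0 v) := by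
  have h := (memLp_id_gaussianReal (μ := 0) (v := v) 1).integrable (by simp)
  exact h.abs

lemma integral_abs_gaussianReal : ∫ x, |x| ∂(gaussianReal 0 1) = √(2 / π) := by
  rw [integral_gaussianReal_eq_integral_smul (by simp)]
  have h1 : (fun x : ℝ => gaussianPDFReal 0 1 x • |x|)
      = fun x => (fun r : ℝ => (√(2 * π))⁻¹ * (r * exp (-(1 / 2) * r ^ 2))) |x| := by
    funext x
    simp only [gaussianPDFReal, smul_eq_mul, sq_abs]
    simp
    ring_nf
  rw [h1, integral_comp_abs (f := fun r : ℝ => (√(2 * π))⁻¹ * (r * exp (-(1 / 2) * r ^ 2))),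
    integral_const_mul]
  have h2 := integral_rpow_mul_exp_neg_mul_rpow (p := 2) (q := 1) (b := 1 / 2)
    (by norm_num) (by norm_num) (by norm_num)
  norm_num at h2 ⊢
  rw [h2]
  field_simp
  exact (sq_sqrt (by norm_num)).symm

lemma integral_abs_gaussianReal_le_one : ∫ x, |x| ∂(gaussianReal 0 1) ≤ 1 := by
  rw [integral_abs_gaussianReal, Real.sqrt_le_one, div_le_one pi_pos]
  exact two_le_pi

/-- Dependence of the Gaussian mean of a Lipschitz function on the variance. -/
lemma abs_gsmooth_sub_le {f f' : ℝ → ℝ} {B : ℝ} (hf : IsTestFunction f f' B) {v : ℝ}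
    (hv0 : 0 ≤ v) (hv1 : v ≤ 1) :
    |gsmooth v.toNNReal f 0 - ∫ x, f x ∂(gaussianReal 0 1)| ≤ 1 - v := by
  have hmap : (gaussianReal 0 1).map (fun x => √v * x) = gaussianReal 0 v.toNNReal := by
    rw [gaussianReal_map_const_mul]
    congr 1
    · simp
    · ext
      simp [hv0]
  have h1 : gsmooth v.toNNReal f 0 = ∫ x, f (√v * x) ∂(gaussianReal 0 1) := by
    simp only [gsmooth, zero_add]
    rw [← hmap, integral_map (by fun_prop) hf.continuous.aestronglyMeasurable]
  have hs : √v ≤ 1 := Real.sqrt_le_one.2 hv1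
  have hsv : v ≤ √v := by
    nlinarith [sq_sqrt hv0, sqrt_nonneg v]
  have hi1 : Integrable (fun x => f (√v * x)) (gaussianReal 0 1) :=
    Integrable.of_bound (hf.continuous.comp (by fun_prop)).aestronglyMeasurable B
      (ae_of_all _ fun _ => hf.bound _)
  have hi2 : Integrable f (gaussianReal 0 1) := by simpa using hf.integrable (gaussianReal 0 1) 0
  rw [h1, ← integral_sub hi1 hi2]
  calc |∫ x, (f (√v * x) - f x) ∂(gaussianReal 0 1)|
      ≤ ∫ x, |f (√v * x) - f x| ∂(gaussianReal 0 1) := abs_integral_le_integral_abs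
    _ ≤ ∫ x, (1 - √v) * |x| ∂(gaussianReal 0 1) := by
        refine integral_mono (hi1.sub hi2).abs ((integrable_abs_gaussianReal 1).const_mul _)
          fun x => (hf.abs_sub_le _ _).trans_eq ?_
        rw [show √v * x - x = -((1 - √v) * x) by ring, abs_neg, abs_mul,
          abs_of_nonneg (sub_nonneg.2 hs)]
    _ ≤ (1 - √v) * 1 := by
        rw [integral_const_mul]
        exact mul_le_mul_of_nonneg_left integral_abs_gaussianReal_le_one (sub_nonneg.2 hs)
    _ ≤ 1 - v := by linarith

lemma abs_Had (ℓ : ℕ) (k i : Fin (2 ^ ℓ)) : |Had ℓ k i| = 1 :=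
  (pow_eq_one_iff_of_nonneg (abs_nonneg _) two_ne_zero).1 (by rw [sq_abs, Had_sq])

/-- The average is Lipschitz in the vector, for the supremum norm. -/
lemma abs_coordAvg_sub_le {f f' : ℝ → ℝ} {B : ℝ} (hf : IsTestFunction f f' B)
    (ℓ m : ℕ) (hm : 0 < m) {z z' : Fin (2 ^ ℓ) → ℝ} {r : ℝ} (hz : ∀ i, |z i - z' i| ≤ r)
    (D : Fin m → Fin (2 ^ ℓ) → ℝ) :
    |coordAvg ℓ m f z D - coordAvg ℓ m f z' D| ≤ (m : ℝ)⁻¹ * r * ∑ j, ∑ i, |D j i| := by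
  have hm' : (0 : ℝ) < m := by exact_mod_cast hm
  have hterm : ∀ j k, |f (hadForm ℓ m D z j k) - f (hadForm ℓ m D z' j k)|
      ≤ r * ∑ i, |D j i| := fun j k => by
    refine (hf.abs_sub_le _ _).trans ?_
    simp only [hadForm, ← Finset.sum_sub_distrib, Finset.mul_sum]
    refine (Finset.abs_sum_le_sum_abs _ _).trans (Finset.sum_le_sum fun i _ => ?_)
    rw [show Had ℓ k i * (D j i * z i) - Had ℓ k i * (D j i * z' i)
      = Had ℓ k i * ((z i - z' i) * D j i) by ring, abs_mul, abs_mul, abs_Had, one_mul]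
    exact mul_le_mul_of_nonneg_right (hz i) (abs_nonneg _)
  simp only [coordAvg, ← mul_sub, ← Finset.sum_sub_distrib]
  rw [abs_mul, abs_of_pos (by positivity)]
  calc _ ≤ ((m : ℝ) * 2 ^ ℓ)⁻¹ * ∑ j : Fin m, ∑ _k : Fin (2 ^ ℓ), r * ∑ i, |D j i| := by
        gcongr
        refine (Finset.abs_sum_le_sum_abs _ _).trans (Finset.sum_le_sum fun j _ =>
          (Finset.abs_sum_le_sum_abs _ _).trans (Finset.sum_le_sum fun k _ => hterm j k))
    _ = _ := by
        simp only [Finset.sum_const, Finset.card_univ, Fintype.card_fin, nsmul_eq_mul,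
          ← Finset.mul_sum]
        push_cast
        field_simp

/-- Off two rare events the average of `f` is uniformly close to its Gaussian mean. -/
lemma abs_coordAvg_sub_integral_lt {f f' : ℝ → ℝ} {B : ℝ} (hf : IsTestFunction f f' B)
    (ℓ m : ℕ) (hm : 0 < m) (P : ℕ) {t : ℝ} {D : Fin m → Fin (2 ^ ℓ) → ℝ}
    (hD : D ∉ gridBad ℓ m f P t) (hD' : ∑ j, ∑ i, |D j i| < 4 * ((m : ℝ) * 2 ^ ℓ))
    {z : Fin (2 ^ ℓ) → ℝ} (hz : ∑ i, z i ^ 2 = 1) :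
    |coordAvg ℓ m f z D - ∫ x, f x ∂(gaussianReal 0 1)| < (P + 1) * t + 6 * 2 ^ ℓ / 2 ^ P := by
  have hm' : (0 : ℝ) < m := by exact_mod_cast hm
  choose w hw1 hw2 using fun i => exists_int_abs_le_abs_sub_le_one (2 ^ P * z i)
  have hMpos : (0 : ℝ) < 2 ^ P := by positivity
  have hle : ∀ i, |(w i : ℝ) / 2 ^ P| ≤ |z i| := fun i => by
    rw [abs_div, abs_of_pos hMpos, div_le_iff₀ hMpos, mul_comm]
    simpa [abs_mul, abs_of_pos hMpos] using hw1 i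
  have hdiff : ∀ i, |z i - (w i : ℝ) / 2 ^ P| ≤ 1 / 2 ^ P := fun i => by
    rw [show z i - (w i : ℝ) / 2 ^ P = (2 ^ P * z i - w i) / 2 ^ P by field_simp, abs_div,
      abs_of_pos hMpos]
    exact div_le_div_of_nonneg_right (hw2 i) hMpos.le
  have hzi : ∀ i, |z i| ≤ 1 := fun i => by
    refine abs_le_one_iff_mul_self_le_one.2 ?_
    rw [← hz, ← pow_two]
    exact Finset.single_le_sum (f := fun i => z i ^ 2) (fun _ _ => sq_nonneg _) (Finset.mem_univ i)
  set V : ℝ := ∑ i, ((w i : ℝ) / 2 ^ P) ^ 2 with hV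
  have hV0 : 0 ≤ V := by positivity
  have hV1 : V ≤ 1 := by
    rw [← hz]
    exact Finset.sum_le_sum fun i _ => sq_le_sq.2 (hle i)
  have hV2 : 1 - V ≤ 2 * 2 ^ ℓ / 2 ^ P := by
    rw [← hz, hV, ← Finset.sum_sub_distrib]
    calc _ ≤ ∑ _i : Fin (2 ^ ℓ), 2 * (1 / (2 : ℝ) ^ P) := by
          refine Finset.sum_le_sum fun i _ => ?_
          rw [sq_sub_sq]
          calc _ ≤ |(z i + (w i : ℝ) / 2 ^ P) * (z i - (w i : ℝ) / 2 ^ P)| := le_abs_self _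
            _ ≤ 2 * (1 / 2 ^ P) := by
                rw [abs_mul]
                refine mul_le_mul ?_ (hdiff i) (abs_nonneg _) (by norm_num)
                linarith [abs_add_le (z i) ((w i : ℝ) / 2 ^ P), hle i, hzi i]
      _ = _ := by
          simp
          ring
  have hwsum : ∑ i, w i ^ 2 ≤ (2 ^ P) ^ 2 := by
    simp only [hV, div_pow, ← Finset.sum_div] at hV1
    rw [div_le_one (by positivity)] at hV1
    exact_mod_cast hV1
  have h1 := abs_coordAvg_grid_sub_lt_of_notMem ℓ m hm P hD hwsum
  have h2 := abs_coordAvg_sub_le hf ℓ m hm hdiff D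
  have h3 := abs_gsmooth_sub_le hf hV0 hV1
  have h4 : (m : ℝ)⁻¹ * (1 / 2 ^ P) * ∑ j, ∑ i, |D j i| ≤ 4 * 2 ^ ℓ / 2 ^ P := by
    calc _ ≤ (m : ℝ)⁻¹ * (1 / 2 ^ P) * (4 * ((m : ℝ) * 2 ^ ℓ)) := by gcongr
      _ = _ := by field_simp
  have h5 : (6 : ℝ) * 2 ^ ℓ / 2 ^ P = 4 * 2 ^ ℓ / 2 ^ P + 2 * 2 ^ ℓ / 2 ^ P := by ring
  rw [h5]
  rw [abs_lt] at h1 ⊢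
  rw [abs_le] at h2 h3
  constructor <;> linarith

lemma half_le_log_of_two_le {x : ℝ} (hx : 2 ≤ x) : 1 / 2 ≤ Real.log x :=
  (by linarith [Real.log_two_gt_d9] : 1 / 2 ≤ Real.log 2).trans
    (Real.log_le_log (by norm_num) hx)

lemma half_le_log_one_div {δ : ℝ} (hδ : δ ∈ Set.Ioo (0 : ℝ) (1 / 2)) :
    1 / 2 ≤ Real.log (1 / δ) :=
  half_le_log_of_two_le (by rw [le_div_iff₀ hδ.1]; linarith [hδ.2])

lemma half_le_log_two_pow_div (ℓ : ℕ) {ε : ℝ} (hε : ε ∈ Set.Ioo (0 : ℝ) (1 / 2)) :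
    1 / 2 ≤ Real.log (2 ^ ℓ / ε) := by
  refine half_le_log_of_two_le ?_
  have h1 : (1 : ℝ) ≤ 2 ^ ℓ := one_le_pow₀ (by norm_num)
  rw [le_div_iff₀ hε.1]
  linarith [hε.2]

/-- A dyadic grid of size comparable with `ℓ` and `ε`. -/
lemma exists_grid_exponent {c₀ : ℝ} (hc₀ : c₀ ∈ Set.Ioc (0 : ℝ) 1) (ℓ : ℕ) {ε : ℝ}
    (hε : ε ∈ Set.Ioo (0 : ℝ) (1 / 2)) :
    ∃ P : ℕ, 6 * 2 ^ ℓ / 2 ^ P ≤ c₀ * ε / 2 ∧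
      P * Real.log 2 ≤ (1 + 2 * Real.log (24 / c₀)) * Real.log (2 ^ ℓ / ε) := by
  obtain ⟨hc, hc1⟩ := hc₀
  have hε0 := hε.1
  have hd : (1 : ℝ) ≤ 2 ^ ℓ := one_le_pow₀ (by norm_num)
  have hx : 1 ≤ 12 * 2 ^ ℓ / (c₀ * ε) := by
    rw [le_div_iff₀ (by positivity)]
    nlinarith [hε.2]
  obtain ⟨n, hn1, hn2⟩ := exists_nat_pow_near hx (by norm_num : (1 : ℝ) < 2)
  refine ⟨n + 1, ?_, ?_⟩
  · rw [div_lt_iff₀ (by positivity)] at hn2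
    rw [div_le_iff₀ (by positivity)]
    linarith
  · have hL := half_le_log_two_pow_div ℓ hε
    have hA : 0 ≤ Real.log (24 / c₀) := Real.log_nonneg (by
      rw [le_div_iff₀ hc]; linarith)
    have h1 : ((n + 1 : ℕ) : ℝ) * Real.log 2 ≤ Real.log ((24 / c₀) * (2 ^ ℓ / ε)) := by
      rw [← Real.log_pow]
      refine Real.log_le_log (by positivity) ?_
      rw [pow_succ]
      calc _ ≤ 12 * 2 ^ ℓ / (c₀ * ε) * 2 := by gcongr
        _ = _ := by field_simp; norm_num
    rw [Real.log_mul (by positivity) (by positivity)] at h1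
    nlinarith

lemma log_gridSize_le {ℓ P : ℕ} {ε A : ℝ} (hε : ε ∈ Set.Ioo (0 : ℝ) (1 / 2))
    (hP : P * Real.log 2 ≤ A * Real.log (2 ^ ℓ / ε)) :
    Real.log (2 ^ ℓ * (2 * 2 ^ P + 1)) ≤ (5 + A) * Real.log (2 ^ ℓ / ε) := by
  have hε0 := hε.1
  have hL := half_le_log_two_pow_div ℓ hε
  have hlog3 : Real.log 3 ≤ 2 := by
    have := Real.log_le_sub_one_of_pos (by norm_num : (0 : ℝ) < 3)
    linarith
  have hd : (1 : ℝ) ≤ 2 ^ ℓ := one_le_pow₀ (by norm_num)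
  have h2P : (1 : ℝ) ≤ 2 ^ P := one_le_pow₀ (by norm_num)
  calc Real.log (2 ^ ℓ * (2 * 2 ^ P + 1)) ≤ Real.log (2 ^ ℓ / ε * (3 * 2 ^ P)) := by
        refine Real.log_le_log (by positivity) ?_
        have : (2 : ℝ) ^ ℓ ≤ 2 ^ ℓ / ε := by
          rw [le_div_iff₀ hε0]
          nlinarith [hε.2]
        gcongr
        linarith
    _ = Real.log (2 ^ ℓ / ε) + (Real.log 3 + P * Real.log 2) := by
        rw [Real.log_mul (x := 2 ^ ℓ / ε) (by positivity) (by positivity),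
          Real.log_mul (x := 3) (by norm_num) (by positivity), Real.log_pow]
    _ ≤ _ := by linarith

lemma log_levels_le {P : ℕ} {δ A L : ℝ} (hδ : 0 < δ) (hL : 1 / 2 ≤ L) (hP : (P : ℝ) ≤ 2 * A * L) :
    Real.log (32 * (P + 1) / δ) ≤ 8 * L + 2 * A * L + Real.log (1 / δ) := by
  have hlog32 : Real.log 32 ≤ 4 := by
    rw [show (32 : ℝ) = 2 ^ 5 by norm_num, Real.log_pow]
    push_cast
    linarith [Real.log_two_lt_d9]
  have h1 : Real.log (32 * (P + 1) / δ) = Real.log 32 + Real.log (P + 1) + Real.log (1 / δ) := by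
    rw [mul_div_assoc, ← mul_one_div ((P : ℝ) + 1),
      Real.log_mul (by norm_num) (by positivity), Real.log_mul (by positivity) (by positivity)]
    ring
  have h2 : Real.log ((P : ℝ) + 1) ≤ P := by
    have := Real.log_le_sub_one_of_pos (by positivity : (0 : ℝ) < (P : ℝ) + 1)
    linarith
  linarith

lemma entropy_le_of_sample_size {A L Δ c₀ ε m N : ℝ} (hA : 1 ≤ A) (hL : 1 / 2 ≤ L)
    (hΔ : 1 / 2 ≤ Δ) (hc₀ : 0 < c₀) (hε : 0 < ε) (hN : 0 < N) (hNA : N ≤ (2 * A + 2) * L)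
    (hm : (78 + 16 * A) * (8 * π ^ 2 * (2 * A + 2) ^ 2) / c₀ ^ 2 * ε⁻¹ ^ 2 * L ^ 5 * Δ ≤ m) :
    (38 + 8 * A) * L + Δ ≤ 2 * (c₀ * ε / (2 * N)) ^ 2 * m / π ^ 2 := by
  have h1 : (38 + 8 * A) * L + Δ ≤ (78 + 16 * A) * (L * Δ) := by
    have h2 : L ≤ 2 * (L * Δ) := by nlinarith
    have h3 : Δ ≤ 2 * (L * Δ) := by nlinarith
    have h4 : (38 + 8 * A) * L ≤ (38 + 8 * A) * (2 * (L * Δ)) := by gcongr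
    linarith
  have h5 : 2 * (c₀ * ε / (2 * N)) ^ 2 * m / π ^ 2
      = c₀ ^ 2 * ε ^ 2 * m / (2 * π ^ 2 * N ^ 2) := by
    field_simp
  refine h1.trans ?_
  rw [h5, le_div_iff₀ (by positivity)]
  have h7 : L ^ 3 ≤ 4 * L ^ 5 := by
    have : 1 / 4 ≤ L ^ 2 := by nlinarith
    calc L ^ 3 = 4 * (L ^ 3 * (1 / 4)) := by ring
      _ ≤ 4 * (L ^ 3 * L ^ 2) := by gcongr
      _ = _ := by ring
  have hA' : 0 < (78 + 16 * A) := by linarith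
  calc (78 + 16 * A) * (L * Δ) * (2 * π ^ 2 * N ^ 2)
      ≤ (78 + 16 * A) * (L * Δ) * (2 * π ^ 2 * ((2 * A + 2) * L) ^ 2) := by gcongr
    _ = (78 + 16 * A) * (2 * π ^ 2 * (2 * A + 2) ^ 2) * Δ * L ^ 3 := by ring
    _ ≤ (78 + 16 * A) * (2 * π ^ 2 * (2 * A + 2) ^ 2) * Δ * (4 * L ^ 5) := by gcongr
    _ = c₀ ^ 2 * ε ^ 2 * ((78 + 16 * A) * (8 * π ^ 2 * (2 * A + 2) ^ 2) / c₀ ^ 2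
          * ε⁻¹ ^ 2 * L ^ 5 * Δ) := by
        field_simp
        ring
    _ ≤ _ := by gcongr

/-- Uniform concentration of the averages of a test function over the unit sphere. -/
theorem exists_measure_coordAvg_le {c₀ : ℝ} (hc₀ : c₀ ∈ Set.Ioc (0 : ℝ) 1) :
    ∃ C : ℝ, 0 < C ∧ ∀ (ℓ : ℕ) (ε δ : ℝ), ε ∈ Set.Ioo (0 : ℝ) (1 / 2) →
      δ ∈ Set.Ioo (0 : ℝ) (1 / 2) → ∀ m : ℕ,
      C * ε⁻¹ ^ 2 * Real.log (2 ^ ℓ / ε) ^ 5 * Real.log (1 / δ) ≤ (m : ℝ) →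
      0 < m ∧ ∀ {f f' : ℝ → ℝ} {B : ℝ}, IsTestFunction f f' B →
      diagMeasure ℓ m {D | ∃ z : Fin (2 ^ ℓ) → ℝ, ∑ i, z i ^ 2 = 1 ∧
        c₀ * ε ≤ |coordAvg ℓ m f z D - ∫ x, f x ∂(gaussianReal 0 1)|} ≤ ENNReal.ofReal (δ / 8) := by
  obtain ⟨hc, hc1⟩ := id hc₀
  have hA1 : 1 ≤ 1 + 2 * Real.log (24 / c₀) := by
    have : 0 ≤ Real.log (24 / c₀) := Real.log_nonneg (by rw [le_div_iff₀ hc]; linarith)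
    linarith
  obtain ⟨A, hA⟩ : ∃ A, A = 1 + 2 * Real.log (24 / c₀) := ⟨_, rfl⟩
  rw [← hA] at hA1
  obtain ⟨C, hC⟩ : ∃ C, C = (78 + 16 * A) * (8 * π ^ 2 * (2 * A + 2) ^ 2) / c₀ ^ 2 := ⟨_, rfl⟩
  have hC128 : 128 ≤ C := by
    rw [hC, le_div_iff₀ (by positivity)]
    have h1 : c₀ ^ 2 ≤ 1 := pow_le_one₀ hc.le hc1
    have h2 : 1 ≤ π ^ 2 := one_le_pow₀ (by linarith [pi_gt_three])
    have h3 : 1 ≤ (2 * A + 2) ^ 2 := one_le_pow₀ (by linarith)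
    have h4 : 1 ≤ π ^ 2 * (2 * A + 2) ^ 2 := one_le_mul_of_one_le_of_one_le h2 h3
    nlinarith
  refine ⟨C, by linarith, fun ℓ ε δ hε hδ m hm => ?_⟩
  have hε0 := hε.1
  have hδ0 := hδ.1
  have hL2 := half_le_log_two_pow_div ℓ hε
  have hΔ2 := half_le_log_one_div hδ
  obtain ⟨P, hP1, hP2⟩ := exists_grid_exponent hc₀ ℓ hε
  rw [← hA] at hP2
  have hlogK := log_gridSize_le hε hP2
  generalize hL : Real.log (2 ^ ℓ / ε) = L at *
  generalize hΔ : Real.log (1 / δ) = Δ at *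
  have hmΔ : 4 * Δ ≤ m := by
    refine le_trans ?_ hm
    have hεinv : 1 ≤ ε⁻¹ ^ 2 := one_le_pow₀ ((one_le_inv₀ hε0).2 (by linarith [hε.2]))
    have h1 : (1 / 2) ^ 5 ≤ L ^ 5 := by gcongr
    calc 4 * Δ = 128 * 1 * (1 / 2) ^ 5 * Δ := by ring
      _ ≤ _ := by gcongr
  have hm' : (0 : ℝ) < m := lt_of_lt_of_le (by positivity) hmΔ
  have hm0 : 0 < m := by exact_mod_cast hm'
  refine ⟨hm0, fun {f f' B} hf => ?_⟩
  have hP0 : (0 : ℝ) ≤ P := Nat.cast_nonneg P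
  have hPA : (P : ℝ) ≤ 2 * A * L := by nlinarith [Real.log_two_gt_d9]
  have hlam := log_levels_le hδ0 hL2 hPA
  rw [hΔ] at hlam
  have hlam0 : 0 ≤ Real.log (32 * (P + 1) / δ) := Real.log_nonneg (by
    rw [le_div_iff₀ hδ0]
    linarith [hδ.2])
  have hmain := entropy_le_of_sample_size (N := (P : ℝ) + 1) hA1 hL2 hΔ2 hc hε0 (by positivity)
    (by linarith) (hC ▸ hm)
  have hb1 := measure_gridBad_le hf ℓ m hm0 P (t := c₀ * ε / (2 * (P + 1))) (by positivity) hlam0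
    (by linarith)
  have hb2 := measure_sum_abs_diag_le ℓ m
  have hsub : {D | ∃ z : Fin (2 ^ ℓ) → ℝ, ∑ i, z i ^ 2 = 1 ∧
      c₀ * ε ≤ |coordAvg ℓ m f z D - ∫ x, f x ∂(gaussianReal 0 1)|} ⊆
      gridBad ℓ m f P (c₀ * ε / (2 * (P + 1))) ∪
        {D | 4 * ((m : ℝ) * 2 ^ ℓ) ≤ ∑ j, ∑ i, |D j i|} := by
    rintro D ⟨z, hz, hzD⟩
    by_contra hD
    simp only [Set.mem_union, not_or, Set.mem_ofPred_eq, not_le] at hD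
    have h1 := abs_coordAvg_sub_integral_lt hf ℓ m hm0 P hD.1 hD.2 hz
    have h2 : ((P : ℝ) + 1) * (c₀ * ε / (2 * (P + 1))) = c₀ * ε / 2 := by field_simp
    linarith
  refine (measure_mono hsub).trans ((measure_union_le _ _).trans ((add_le_add hb1 hb2).trans ?_))
  rw [← ENNReal.ofReal_add (by positivity) (by positivity)]
  refine ENNReal.ofReal_le_ofReal ?_
  have h1 : ((P : ℝ) + 1) * (2 * exp (-Real.log (32 * (P + 1) / δ))) = δ / 16 := by
    rw [exp_neg, exp_log (by positivity)]
    field_simp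
    norm_num
  have h2 : exp (-(2 * ((m : ℝ) * 2 ^ ℓ))) ≤ δ / 16 := by
    have h3 : δ / 16 = exp (-(4 * Real.log 2 + Δ)) := by
      rw [← hΔ, one_div, Real.log_inv, ← sub_eq_add_neg, neg_sub, exp_sub, exp_log hδ0,
        show (4 : ℝ) * Real.log 2 = ((4 : ℕ) : ℝ) * Real.log 2 by norm_num, ← Real.log_pow,
        exp_log (by norm_num)]
      norm_num
    rw [h3, exp_le_exp, neg_le_neg_iff]
    have hd : (1 : ℝ) ≤ 2 ^ ℓ := one_le_pow₀ (by norm_num)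
    nlinarith [Real.log_two_lt_d9]
  linarith

/-- Hoeffding's inequality for the empirical mean of i.i.d. samples. -/
lemma measure_empirical_sub_integral_le {α : Type*} [MeasurableSpace α] (ν : Measure α)
    [IsProbabilityMeasure ν] {h : α → ℝ} (hh : Measurable h) {R : ℝ} (hR : 0 < R)
    (h0 : ∀ a, h a ∈ Set.Icc 0 R) {k : ℕ} (hk : 0 < k) {t : ℝ} (ht : 0 ≤ t) :
    (Measure.pi fun _ : Fin k => ν) {L | t ≤ |1 / (k : ℝ) * ∑ p, h (L p) - ∫ a, h a ∂ν|}
      ≤ ENNReal.ofReal (2 * exp (-(2 * k * t ^ 2 / R ^ 2))) := by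
  have hk' : (0 : ℝ) < k := by exact_mod_cast hk
  have key : ∀ {g : α → ℝ}, Measurable g →
      HasSubgaussianMGF g ((‖R - 0‖₊ / 2) ^ 2) ν →
      (Measure.pi fun _ : Fin k => ν).real {L | k * t ≤ ∑ p, g (L p)}
        ≤ exp (-(2 * k * t ^ 2 / R ^ 2)) := by
    intro g hg hsub
    have hind : iIndepFun (fun p (L : Fin k → α) => g (L p)) (Measure.pi fun _ : Fin k => ν) :=
      iIndepFun_pi (X := fun _ => g) fun _ => hg.aemeasurable
    refine (HasSubgaussianMGF.measure_sum_ge_le_of_iIndepFun hind (s := Finset.univ)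
      (c := fun _ => (‖R - 0‖₊ / 2) ^ 2) (fun p _ => ?_) (by positivity : 0 ≤ k * t)).trans_eq ?_
    · have hmp := measurePreserving_eval (fun _ : Fin k => ν) p
      exact HasSubgaussianMGF.of_map (Y := Function.eval p) (X := g) hmp.measurable.aemeasurable
        (by rw [hmp.map_eq]; exact hsub)
    · congr 1
      simp only [Finset.sum_const, Finset.card_univ, Fintype.card_fin, nsmul_eq_mul]
      push_cast
      rw [sub_zero, Real.norm_of_nonneg hR.le]
      field_simp
  have hsub := hasSubgaussianMGF_of_mem_Icc (μ := ν) hh.aemeasurable (ae_of_all _ h0)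
  have h1 := key (hh.sub_const _) hsub
  have h2 := key (hh.sub_const _).neg hsub.neg
  rw [← ofReal_measureReal]
  refine ENNReal.ofReal_le_ofReal ((measureReal_mono (fun L hL => ?_) (by finiteness)).trans
    ((measureReal_union_le _ _).trans ((add_le_add h1 h2).trans_eq (by ring))))
  have hL' : (k : ℝ) * t ≤ |∑ p, (h (L p) - ∫ a, h a ∂ν)| := by
    have h3 : ∑ p, (h (L p) - ∫ a, h a ∂ν)
        = k * (1 / (k : ℝ) * ∑ p, h (L p) - ∫ a, h a ∂ν) := by
      rw [Finset.sum_sub_distrib]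
      simp
      field_simp
    rw [h3, abs_mul, abs_of_pos hk']
    exact mul_le_mul_of_nonneg_left hL hk'.le
  rcases le_abs.1 hL' with h | h
  · exact Or.inl h
  · refine Or.inr ?_
    simpa [Finset.sum_neg_distrib] using h

lemma isProbabilityMeasure_unifIndex (ℓ : ℕ) {m : ℕ} (hm : 0 < m) :
    IsProbabilityMeasure (unifIndex ℓ m) := by
  refine ⟨?_⟩
  have h0 : ((m * 2 ^ ℓ : ℕ) : ℝ≥0∞) ≠ 0 := by
    have : 0 < m * 2 ^ ℓ := by positivity
    exact_mod_cast this.ne'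
  rw [unifIndex, Measure.smul_apply, Measure.count_apply MeasurableSet.univ, smul_eq_mul]
  simp only [Set.encard_univ, ENat.card_eq_coe_fintype_card, Fintype.card_prod, Fintype.card_fin]
  exact ENNReal.inv_mul_cancel h0 (ENNReal.natCast_ne_top _)

lemma integral_unifIndex (ℓ m : ℕ) (h : Fin m × Fin (2 ^ ℓ) → ℝ) :
    ∫ a, h a ∂(unifIndex ℓ m) = ((m : ℝ) * 2 ^ ℓ)⁻¹ * ∑ j, ∑ k, h (j, k) := by
  rw [unifIndex, integral_smul_measure, integral_count, smul_eq_mul, Fintype.sum_prod_type]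
  simp

/-- The empirical mean of `f` over the sampled entries of the transform of `z`. -/
def sampleAvg (ℓ m k : ℕ) (f : ℝ → ℝ) (z : Fin (2 ^ ℓ) → ℝ) (D : Fin m → Fin (2 ^ ℓ) → ℝ)
    (L : Fin k → Fin m × Fin (2 ^ ℓ)) : ℝ :=
  1 / (k : ℝ) * ∑ p, f (hadForm ℓ m D z (L p).1 (L p).2)

lemma continuous_sampleAvg (ℓ m k : ℕ) {f : ℝ → ℝ} (hf : Continuous f) (z : Fin (2 ^ ℓ) → ℝ)
    (L : Fin k → Fin m × Fin (2 ^ ℓ)) : Continuous fun D => sampleAvg ℓ m k f z D L := by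
  unfold sampleAvg
  refine continuous_const.mul (continuous_finsetSum _ fun p _ => ?_)
  exact hf.comp (continuous_hadForm ℓ m z _ _)

/-- For every fixed `D`, and hence for the product measure, the empirical mean is close to the
average over all entries. -/
lemma measure_sampleAvg_sub_le (ℓ : ℕ) {m k : ℕ} (hm : 0 < m) (hk : 0 < k) {f : ℝ → ℝ}
    (hf : Continuous f) {R : ℝ} (hR : 0 < R) (h0 : ∀ x, f x ∈ Set.Icc 0 R)
    (z : Fin (2 ^ ℓ) → ℝ) {t : ℝ} (ht : 0 ≤ t) :
    ((diagMeasure ℓ m).prod (indexMeasure ℓ m k))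
      {p | t ≤ |sampleAvg ℓ m k f z p.1 p.2 - coordAvg ℓ m f z p.1|}
      ≤ ENNReal.ofReal (2 * exp (-(2 * k * t ^ 2 / R ^ 2))) := by
  have := isProbabilityMeasure_unifIndex ℓ hm
  have : IsProbabilityMeasure (indexMeasure ℓ m k) := by unfold indexMeasure; infer_instance
  have hmeas : MeasurableSet {p : (Fin m → Fin (2 ^ ℓ) → ℝ) × (Fin k → Fin m × Fin (2 ^ ℓ)) |
      t ≤ |sampleAvg ℓ m k f z p.1 p.2 - coordAvg ℓ m f z p.1|} := by
    refine measurableSet_le measurable_const (Measurable.abs (Measurable.sub ?_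
      ((continuous_coordAvg ℓ m hf z).measurable.comp measurable_fst)))
    refine measurable_from_prod_countable_left fun L => ?_
    exact (continuous_sampleAvg ℓ m k hf z L).measurable
  rw [Measure.prod_apply hmeas]
  calc _ ≤ ∫⁻ _, ENNReal.ofReal (2 * exp (-(2 * k * t ^ 2 / R ^ 2))) ∂(diagMeasure ℓ m) := by
        refine lintegral_mono fun D => ?_
        have h := measure_empirical_sub_integral_le (unifIndex ℓ m)
          (h := fun a => f (hadForm ℓ m D z a.1 a.2)) (measurable_of_finite _) hR
          (fun a => h0 _) hk ht
        rw [integral_unifIndex] at h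
        exact h
    _ = _ := by simp

lemma hasDerivAt_sqrt_sq_add {τ : ℝ} (hτ : 0 < τ) (x : ℝ) :
    HasDerivAt (fun x => √(x ^ 2 + τ ^ 2)) (x / √(x ^ 2 + τ ^ 2)) x := by
  have h := ((hasDerivAt_pow 2 x).add_const (τ ^ 2)).sqrt (by positivity)
  convert h using 1
  push_cast
  field_simp

lemma abs_div_sqrt_sq_add_le (τ x : ℝ) : |x / √(x ^ 2 + τ ^ 2)| ≤ 1 := by
  rw [abs_div, abs_of_nonneg (sqrt_nonneg _)]
  exact div_le_one_of_le₀ (abs_le_sqrt (by nlinarith [sq_nonneg τ])) (sqrt_nonneg _)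

lemma sqrt_sq_add_le {τ : ℝ} (hτ : 0 < τ) (x : ℝ) : √(x ^ 2 + τ ^ 2) ≤ |x| + τ :=
  sqrt_le_iff.2 ⟨by positivity, by nlinarith [sq_abs x, abs_nonneg x]⟩

lemma abs_le_sqrt_sq_add (τ x : ℝ) : |x| ≤ √(x ^ 2 + τ ^ 2) :=
  abs_le_sqrt (by nlinarith [sq_nonneg τ])

/-- A smooth version of `min |x| r`. -/
def smoothClip (r τ x : ℝ) : ℝ :=
  (√(x ^ 2 + τ ^ 2) + r - √((√(x ^ 2 + τ ^ 2) - r) ^ 2 + τ ^ 2)) / 2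

lemma abs_smoothClip_sub_le (r : ℝ) {τ : ℝ} (hτ : 0 < τ) (x : ℝ) :
    |smoothClip r τ x - min |x| r| ≤ τ := by
  have h1 := sqrt_sq_add_le hτ x
  have h2 := abs_le_sqrt_sq_add τ x
  unfold smoothClip
  generalize √(x ^ 2 + τ ^ 2) = g at *
  have h3 := sqrt_sq_add_le hτ (g - r)
  have h4 := abs_le_sqrt_sq_add τ (g - r)
  generalize √((g - r) ^ 2 + τ ^ 2) = s at *
  rw [abs_le]
  rcases abs_cases (g - r) with ⟨h5, _⟩ | ⟨h5, _⟩ <;> rcases min_cases |x| r with ⟨h6, _⟩ | ⟨h6, _⟩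
    <;> rw [h5] at h3 h4 <;> rw [h6] <;> constructor <;> linarith

lemma isTestFunction_smoothClip {r τ : ℝ} (hr : 0 ≤ r) (hτ : 0 < τ) :
    IsTestFunction (smoothClip r τ)
      (fun x => x / √(x ^ 2 + τ ^ 2) * ((1 - (√(x ^ 2 + τ ^ 2) - r) /
        √((√(x ^ 2 + τ ^ 2) - r) ^ 2 + τ ^ 2)) / 2)) (r + τ) where
  hasDerivAt x := by
    have h1 := hasDerivAt_sqrt_sq_add hτ x
    have h2 := (hasDerivAt_sqrt_sq_add hτ (√(x ^ 2 + τ ^ 2) - r)).comp x (h1.sub_const r)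
    have h3 := (((h1.add_const r).sub h2).div_const 2)
    refine h3.congr_deriv ?_
    ring
  continuous_deriv := by
    have h : ∀ y : ℝ, √(y ^ 2 + τ ^ 2) ≠ 0 := fun y => by positivity
    fun_prop (disch := intro; apply h)
  deriv_le x := by
    rw [abs_mul]
    refine mul_le_one₀ (abs_div_sqrt_sq_add_le τ x) (abs_nonneg _) ?_
    have := abs_le.1 (abs_div_sqrt_sq_add_le τ (√(x ^ 2 + τ ^ 2) - r))
    rw [abs_le]
    constructor <;> linarith
  bound x := by
    have h1 := abs_le.1 (abs_smoothClip_sub_le r hτ x)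
    have h2 : 0 ≤ min |x| r := le_min (abs_nonneg x) hr
    have h3 : min |x| r ≤ r := min_le_right _ _
    rw [abs_le]
    constructor <;> linarith

lemma exists_abs_deriv_smoothTransition_le :
    ∃ K : ℝ, 1 ≤ K ∧ ∀ x, |deriv smoothTransition x| ≤ K := by
  have hc : Continuous (deriv smoothTransition) :=
    (smoothTransition.contDiff (n := 1)).continuous_deriv le_rfl
  obtain ⟨K, hK⟩ := (isCompact_Icc (a := (0 : ℝ)) (b := 1)).exists_bound_of_continuousOn
    hc.continuousOn
  refine ⟨max 1 K, le_max_left _ _, fun x => ?_⟩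
  by_cases hx : x ∈ Set.Icc (0 : ℝ) 1
  · exact (hK x hx).trans (le_max_right _ _)
  · have h0 : deriv smoothTransition x = 0 := by
      rcases lt_or_ge x 0 with h | h
      · have : smoothTransition =ᶠ[nhds x] fun _ => 0 := by
          filter_upwards [Iio_mem_nhds h] with y hy
          exact smoothTransition.zero_of_nonpos (le_of_lt hy)
        rw [this.deriv_eq, deriv_const]
      · have h1 : 1 < x := by
          by_contra h2
          exact hx ⟨h, not_lt.1 h2⟩
        have : smoothTransition =ᶠ[nhds x] fun _ => 1 := by
          filter_upwards [Ioi_mem_nhds h1] with y hy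
          exact smoothTransition.one_of_one_le (le_of_lt hy)
        rw [this.deriv_eq, deriv_const]
    rw [h0, abs_zero]
    positivity

lemma isTestFunction_smoothTransition {K : ℝ} (hK1 : 1 ≤ K)
    (hK : ∀ x, |deriv smoothTransition x| ≤ K) (a : ℝ) :
    IsTestFunction (fun x => smoothTransition (x - a) / K)
      (fun x => deriv smoothTransition (x - a) / K) 1 where
  hasDerivAt x := by
    have h := ((smoothTransition.contDiff (n := 1)).differentiable one_ne_zero
      (x - a)).hasDerivAt
    simpa using (HasDerivAt.comp_sub_const x a h).div_const K
  continuous_deriv := by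
    have hc : Continuous (deriv smoothTransition) :=
      (smoothTransition.contDiff (n := 1)).continuous_deriv le_rfl
    fun_prop
  deriv_le x := by
    rw [abs_div, abs_of_pos (by linarith : 0 < K)]
    exact div_le_one_of_le₀ (hK _) (by linarith)
  bound x := by
    rw [abs_div, abs_of_nonneg (smoothTransition.nonneg _), abs_of_pos (by linarith : 0 < K)]
    exact div_le_one_of_le₀ ((smoothTransition.le_one _).trans hK1) (by linarith)

lemma measureReal_gaussianReal_Ioo_pos {a b : ℝ} (h : a < b) :
    0 < (gaussianReal 0 1).real (Set.Ioo a b) := by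
  refine ENNReal.toReal_pos (fun h0 => ?_) (by finiteness)
  have := gaussianReal_absolutelyContinuous' 0 (v := 1) one_ne_zero h0
  simp [h.not_ge] at this

lemma measureReal_gaussianReal_Ioi_lt {a b : ℝ} (h : a < b) :
    (gaussianReal 0 1).real (Set.Ioi b) < (gaussianReal 0 1).real (Set.Ioi a) := by
  have hd : Disjoint (Set.Ioi b) (Set.Ioo a b) :=
    Set.disjoint_left.2 fun x hx hx' => lt_asymm (Set.mem_Ioi.1 hx) hx'.2
  have h1 : (gaussianReal 0 1).real (Set.Ioi b) + (gaussianReal 0 1).real (Set.Ioo a b)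
      ≤ (gaussianReal 0 1).real (Set.Ioi a) := by
    rw [← measureReal_union hd measurableSet_Ioo]
    refine measureReal_mono ?_ (by finiteness)
    rintro x (hx | hx)
    · exact h.trans hx
    · exact hx.1
  linarith [measureReal_gaussianReal_Ioo_pos h]

lemma one_sub_gaussAlpha : 1 - gaussAlpha = (gaussianReal 0 1).real (Set.Ioi 3) := by
  have := probReal_compl_eq_one_sub (μ := gaussianReal 0 1) (s := Set.Iic 3) measurableSet_Iic
  rw [Set.compl_Iic] at this
  rw [this]
  rfl

lemma gaussAlpha_pos : 0 < gaussAlpha := by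
  refine (measureReal_gaussianReal_Ioo_pos (a := 0) (b := 3) (by norm_num)).trans_le ?_
  exact measureReal_mono (fun x hx => le_of_lt hx.2) (by finiteness)

lemma integrable_smoothTransition (a : ℝ) :
    Integrable (fun x => smoothTransition (x - a)) (gaussianReal 0 1) :=
  Integrable.of_bound (smoothTransition.continuous.comp
    (continuous_id.sub continuous_const)).aestronglyMeasurable 1 (ae_of_all _ fun x => by
      rw [Real.norm_of_nonneg (smoothTransition.nonneg _)]
      exact smoothTransition.le_one _)

lemma one_sub_gaussAlpha_lt_integral :
    1 - gaussAlpha < ∫ x, smoothTransition (x - 1) ∂(gaussianReal 0 1) := by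
  have h1 : (gaussianReal 0 1).real (Set.Ioi 2)
      ≤ ∫ x, smoothTransition (x - 1) ∂(gaussianReal 0 1) := by
    rw [← integral_indicator_one measurableSet_Ioi]
    refine integral_mono ((integrable_const 1).indicator measurableSet_Ioi)
      (integrable_smoothTransition 1) fun x => ?_
    by_cases hx : x ∈ Set.Ioi (2 : ℝ)
    · have : 1 ≤ x - 1 := by linarith [Set.mem_Ioi.1 hx]
      simp [hx, smoothTransition.one_of_one_le this]
    · simp only [Set.indicator_of_notMem hx]
      exact smoothTransition.nonneg _
  rw [one_sub_gaussAlpha]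
  exact (measureReal_gaussianReal_Ioi_lt (by norm_num)).trans_le h1

lemma integral_lt_one_sub_gaussAlpha :
    ∫ x, smoothTransition (x - 4) ∂(gaussianReal 0 1) < 1 - gaussAlpha := by
  have h1 : ∫ x, smoothTransition (x - 4) ∂(gaussianReal 0 1)
      ≤ (gaussianReal 0 1).real (Set.Ioi 4) := by
    rw [← integral_indicator_one measurableSet_Ioi]
    refine integral_mono (integrable_smoothTransition 4)
      ((integrable_const 1).indicator measurableSet_Ioi) fun x => ?_
    by_cases hx : x ∈ Set.Ioi (4 : ℝ)
    · simp only [Set.indicator_of_mem hx]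
      exact smoothTransition.le_one _
    · have : x - 4 ≤ 0 := by linarith [not_lt.1 (fun h => hx (Set.mem_Ioi.2 h))]
      simp [hx, smoothTransition.zero_of_nonpos this]
  rw [one_sub_gaussAlpha]
  exact h1.trans_lt (measureReal_gaussianReal_Ioi_lt (by norm_num))

/-- The loss caused by clipping the absolute value of a Gaussian at `r`. -/
lemma le_integral_min_abs {r : ℝ} (hr : 1 ≤ r) :
    √(2 / π) - exp (-(r ^ 2 / 2)) ≤ ∫ x, min |x| r ∂(gaussianReal 0 1) := by
  have hpt : ∀ x : ℝ, |x| - min |x| r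
      ≤ exp (-r ^ 2) / 2 * (exp (r * x) + exp (-r * x)) := fun x => by
    have h2 : (2 : ℝ) ≤ exp 1 := by have := add_one_le_exp (1 : ℝ); linarith
    have h3 : exp (-r ^ 2) * exp (r * |x|) / 2
        ≤ exp (-r ^ 2) / 2 * (exp (r * x) + exp (-r * x)) := by
      have := exp_pos (r * x)
      have := exp_pos (-r * x)
      have := exp_pos (-r ^ 2)
      rcases abs_cases x with ⟨h, _⟩ | ⟨h, _⟩
      · rw [h]; nlinarith
      · rw [h, mul_neg, ← neg_mul]; nlinarith
    refine le_trans ?_ h3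
    rcases min_cases |x| r with ⟨h, _⟩ | ⟨h, hx⟩
    · rw [h, sub_self]; positivity
    · rw [h]
      have h4 : r * (|x| - r) ≤ exp (r * (|x| - r) - 1) := by
        have := add_one_le_exp (r * (|x| - r) - 1); linarith
      have h5 : exp (r * (|x| - r) - 1) = exp (-r ^ 2) * exp (r * |x|) / exp 1 := by
        rw [← exp_add, ← exp_sub]; ring_nf
      have h6 : exp (-r ^ 2) * exp (r * |x|) / exp 1 ≤ exp (-r ^ 2) * exp (r * |x|) / 2 := by
        gcongr
      nlinarith
  have hi1 := integrable_abs_gaussianReal 1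
  have hi2 : Integrable (fun x => min |x| r) (gaussianReal 0 1) :=
    hi1.inf (integrable_const r)
  have hi3 := ((integrable_exp_mul_gaussianReal (μ := 0) (v := 1) r).add
    (integrable_exp_mul_gaussianReal (μ := 0) (v := 1) (-r))).const_mul (exp (-r ^ 2) / 2)
  have h := integral_mono (hi1.sub hi2) hi3 hpt
  simp only [Pi.sub_apply, Pi.add_apply] at h
  rw [integral_sub hi1 hi2, integral_abs_gaussianReal, integral_const_mul,
    integral_add (integrable_exp_mul_gaussianReal r) (integrable_exp_mul_gaussianReal (-r)),
    integral_exp_mul_gaussianReal, integral_exp_mul_gaussianReal] at h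
  have h7 : exp (-r ^ 2) / 2 * (exp (r ^ 2 / 2) + exp ((-r) ^ 2 / 2)) = exp (-(r ^ 2 / 2)) := by
    rw [neg_sq, ← two_mul, div_mul_eq_mul_div, mul_left_comm, mul_div_cancel_left₀ _ two_ne_zero,
      ← exp_add]
    ring_nf
  linarith

lemma integral_min_abs_le (r : ℝ) : ∫ x, min |x| r ∂(gaussianReal 0 1) ≤ √(2 / π) := by
  have hi1 := integrable_abs_gaussianReal 1
  rw [← integral_abs_gaussianReal]
  exact integral_mono (hi1.inf (integrable_const r)) hi1 fun x => min_le_left _ _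

lemma quant_le {ι : Type*} [Fintype ι] [Nonempty ι] {α : ℝ} (hα : 0 < α) {v : ι → ℝ} {b : ℝ}
    (h : α * (Fintype.card ι : ℝ) ≤ ((Finset.univ.filter fun p => v p ≤ b).card : ℝ)) :
    quant α v ≤ b := by
  have hcard : (0 : ℝ) < Fintype.card ι := by exact_mod_cast Fintype.card_pos
  have hne : (Finset.univ.filter fun p => v p ≤ b).Nonempty := by
    rw [← Finset.card_pos]
    exact_mod_cast (mul_pos hα hcard).trans_le h
  obtain ⟨p₀, hp₀, hmax⟩ := Finset.exists_max_image _ v hne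
  refine le_trans (b := v p₀) (csInf_le ?_ ⟨⟨p₀, rfl⟩, h.trans ?_⟩) (Finset.mem_filter.1 hp₀).2
  · exact ((Set.finite_range v).subset fun s hs => hs.1).bddBelow
  · exact_mod_cast Finset.card_le_card fun p hp =>
      Finset.mem_filter.2 ⟨Finset.mem_univ p, hmax p hp⟩

lemma le_quant {ι : Type*} [Fintype ι] [Nonempty ι] {α : ℝ} (hα : α ≤ 1) {v : ι → ℝ} {a : ℝ}
    (h : ((Finset.univ.filter fun p => v p < a).card : ℝ) < α * (Fintype.card ι : ℝ)) :
    a ≤ quant α v := by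
  refine le_csInf ?_ fun s hs => ?_
  · obtain ⟨p₀, -, hmax⟩ := Finset.exists_max_image Finset.univ v Finset.univ_nonempty
    refine ⟨v p₀, ⟨p₀, rfl⟩, ?_⟩
    rw [Finset.filter_true_of_mem hmax, Finset.card_univ]
    exact mul_le_of_le_one_left (Nat.cast_nonneg _) hα
  · by_contra hsa
    refine absurd (hs.2.trans ?_) h.not_ge
    exact_mod_cast Finset.card_le_card (Finset.monotone_filter_right _ fun p _ hp =>
      lt_of_le_of_lt hp (not_le.1 hsa))

lemma gaussAlpha_le_one : gaussAlpha ≤ 1 := by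
  have := one_sub_gaussAlpha
  have := measureReal_nonneg (μ := gaussianReal 0 1) (s := Set.Ioi (3 : ℝ))
  linarith

lemma sum_smoothTransition_le {ι : Type*} [Fintype ι] (w : ι → ℝ) (a : ℝ) :
    ∑ p, smoothTransition (w p - a)
      ≤ Fintype.card ι - ((Finset.univ.filter fun p => w p < a).card : ℝ) := by
  have h1 : (Fintype.card ι : ℝ) - ((Finset.univ.filter fun p => w p < a).card : ℝ)
      = ∑ p, (1 - if w p < a then (1 : ℝ) else 0) := by simp
  rw [h1]
  refine Finset.sum_le_sum fun p _ => ?_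
  split_ifs with hp
  · rw [smoothTransition.zero_of_nonpos (by linarith), sub_self]
  · rw [sub_zero]
    exact smoothTransition.le_one _

lemma le_sum_smoothTransition {ι : Type*} [Fintype ι] (w : ι → ℝ) (a : ℝ) :
    Fintype.card ι - ((Finset.univ.filter fun p => w p ≤ a + 1).card : ℝ)
      ≤ ∑ p, smoothTransition (w p - a) := by
  have h1 : (Fintype.card ι : ℝ) - ((Finset.univ.filter fun p => w p ≤ a + 1).card : ℝ)
      = ∑ p, (1 - if w p ≤ a + 1 then (1 : ℝ) else 0) := by simp
  rw [h1]
  refine Finset.sum_le_sum fun p _ => ?_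
  split_ifs with hp
  · rw [sub_self]
    exact smoothTransition.nonneg _
  · rw [smoothTransition.one_of_one_le (by linarith), sub_zero]

/-- If the empirical tails of `w` are close to the Gaussian ones, then the quantile of `ρ • w` is
comparable with `ρ`. -/
lemma quant_mem_Icc {k : ℕ} (hk : 0 < k) {w : Fin k → ℝ} {ρ : ℝ} (hρ : 0 < ρ)
    (h1 : 1 - gaussAlpha < 1 / (k : ℝ) * ∑ p, smoothTransition (w p - 1))
    (h4 : 1 / (k : ℝ) * ∑ p, smoothTransition (w p - 4) < 1 - gaussAlpha) :
    quant gaussAlpha (fun p => ρ * w p) ∈ Set.Icc ρ (5 * ρ) := by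
  have hk' : (0 : ℝ) < k := by exact_mod_cast hk
  have : Nonempty (Fin k) := ⟨⟨0, hk⟩⟩
  have h1' := sum_smoothTransition_le w 1
  have h4' := le_sum_smoothTransition w 4
  rw [one_div, lt_inv_mul_iff₀ hk'] at h1
  rw [one_div, inv_mul_lt_iff₀ hk'] at h4
  rw [Fintype.card_fin] at h1' h4'
  constructor
  · refine le_quant gaussAlpha_le_one ?_
    have : ∀ p, ρ * w p < ρ ↔ w p < 1 := fun p => mul_lt_iff_lt_one_right hρ
    simp only [this, Fintype.card_fin]
    linarith
  · refine quant_le gaussAlpha_pos ?_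
    have : ∀ p, ρ * w p ≤ 5 * ρ ↔ w p ≤ 4 + 1 := fun p => by
      rw [mul_comm, mul_le_mul_iff_left₀ hρ]; norm_num
    simp only [this, Fintype.card_fin]
    linarith

lemma rht_sub_rht (ℓ m : ℕ) (D : Fin m → Fin (2 ^ ℓ) → ℝ)
    (q x : EuclideanSpace ℝ (Fin (2 ^ ℓ))) {ρ : ℝ} (hρ : ρ ≠ 0) (j : Fin m) (k : Fin (2 ^ ℓ)) :
    rht ℓ m D q j k - rht ℓ m D x j k = ρ * hadForm ℓ m D (fun i => (q i - x i) / ρ) j k := by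
  rw [rht_eq_hadForm, rht_eq_hadForm, hadForm, hadForm, hadForm, ← Finset.sum_sub_distrib,
    Finset.mul_sum]
  refine Finset.sum_congr rfl fun i _ => ?_
  field_simp

/-- The distance estimate lies between two rescaled clipped averages. -/
lemma distEstimate_mem_Icc {ℓ m k : ℕ} (hk : 0 < k) (ε : ℝ) {D : Fin m → Fin (2 ^ ℓ) → ℝ}
    {L : Fin k → Fin m × Fin (2 ^ ℓ)} {q x : EuclideanSpace ℝ (Fin (2 ^ ℓ))} {ρ : ℝ} (hρ : 0 < ρ)
    (h1 : 1 - gaussAlpha < sampleAvg ℓ m k (fun x => smoothTransition (x - 1))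
      (fun i => (q i - x i) / ρ) D L)
    (h4 : sampleAvg ℓ m k (fun x => smoothTransition (x - 4))
      (fun i => (q i - x i) / ρ) D L < 1 - gaussAlpha) :
    distEstimate ℓ m k ε D L q x ∈ Set.Icc
      (√(π / 2) * sampleAvg ℓ m k (fun y => min |y| (2 * √(Real.log (1 / ε))))
        (fun i => (q i - x i) / ρ) D L * ρ)
      (√(π / 2) * sampleAvg ℓ m k (fun y => min |y| (10 * √(Real.log (1 / ε))))
        (fun i => (q i - x i) / ρ) D L * ρ) := by
  obtain ⟨hq1, hq2⟩ := quant_mem_Icc hk hρ h1 h4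
  have hs := sqrt_nonneg (Real.log (1 / ε))
  have hsc : ∀ y r : ℝ, min |y| r * ρ = min |ρ * y| (r * ρ) := fun y r => by
    rw [min_mul_of_nonneg _ _ hρ.le, abs_mul, abs_of_pos hρ, mul_comm ρ]
  unfold distEstimate sampleAvg
  simp only [rht_sub_rht ℓ m D q x hρ.ne']
  constructor
  · rw [show ∀ a b c d : ℝ, a * (b * c) * d = b * a * (c * d) from fun a b c d => by ring,
      Finset.sum_mul]
    refine mul_le_mul_of_nonneg_left (Finset.sum_le_sum fun p _ => ?_) (by positivity)
    rw [hsc]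
    exact min_le_min_left _ (mul_le_mul_of_nonneg_left hq1 (by positivity))
  · rw [show ∀ a b c d : ℝ, a * (b * c) * d = b * a * (c * d) from fun a b c d => by ring,
      Finset.sum_mul]
    refine mul_le_mul_of_nonneg_left (Finset.sum_le_sum fun p _ => ?_) (by positivity)
    rw [hsc]
    refine min_le_min_left _ ((mul_le_mul_of_nonneg_left hq2 (by positivity)).trans_eq (by ring))

lemma distEstimate_self (ℓ m k : ℕ) (ε : ℝ) (D : Fin m → Fin (2 ^ ℓ) → ℝ)
    (L : Fin k → Fin m × Fin (2 ^ ℓ)) (q : EuclideanSpace ℝ (Fin (2 ^ ℓ))) :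
    distEstimate ℓ m k ε D L q q = 0 := by
  have h : 0 ≤ quant gaussAlpha fun _ : Fin k => (0 : ℝ) := by
    refine Real.sInf_nonneg ?_
    rintro s ⟨⟨_, rfl⟩, -⟩
    exact le_rfl
  unfold distEstimate
  simp only [sub_self, abs_zero]
  rw [min_eq_left (by positivity)]
  simp

lemma abs_coordAvg_sub_coordAvg_le (ℓ : ℕ) {m : ℕ} (hm : 0 < m) {f h : ℝ → ℝ} {τ : ℝ}
    (hfh : ∀ x, |f x - h x| ≤ τ) (z : Fin (2 ^ ℓ) → ℝ) (D : Fin m → Fin (2 ^ ℓ) → ℝ) :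
    |coordAvg ℓ m f z D - coordAvg ℓ m h z D| ≤ τ := by
  have hm' : (0 : ℝ) < m := by exact_mod_cast hm
  unfold coordAvg
  rw [← mul_sub, abs_mul, abs_of_pos (by positivity), inv_mul_le_iff₀ (by positivity),
    ← Finset.sum_sub_distrib]
  calc |∑ j, (∑ k, f (hadForm ℓ m D z j k) - ∑ k, h (hadForm ℓ m D z j k))|
      ≤ ∑ j : Fin m, ∑ k : Fin (2 ^ ℓ), τ := by
        refine (Finset.abs_sum_le_sum_abs _ _).trans (Finset.sum_le_sum fun j _ => ?_)
        rw [← Finset.sum_sub_distrib]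
        exact (Finset.abs_sum_le_sum_abs _ _).trans (Finset.sum_le_sum fun k _ => hfh _)
    _ = m * 2 ^ ℓ * τ := by simp [mul_assoc]

/-- Uniform concentration passes from a test function to a function at distance `τ` of it. -/
lemma setOf_coordAvg_subset (ℓ : ℕ) {m : ℕ} (hm : 0 < m) {f h : ℝ → ℝ} {τ : ℝ}
    (hfh : ∀ x, |f x - h x| ≤ τ) (hf : Integrable f (gaussianReal 0 1))
    (hh : Integrable h (gaussianReal 0 1)) (η : ℝ) :
    {D | ∃ z, ∑ i, z i ^ 2 = 1 ∧
      η + 2 * τ ≤ |coordAvg ℓ m h z D - ∫ x, h x ∂(gaussianReal 0 1)|} ⊆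
    {D | ∃ z, ∑ i, z i ^ 2 = 1 ∧ η ≤ |coordAvg ℓ m f z D - ∫ x, f x ∂(gaussianReal 0 1)|} := by
  rintro D ⟨z, hz, hD⟩
  refine ⟨z, hz, ?_⟩
  have h1 := abs_coordAvg_sub_coordAvg_le ℓ hm hfh z D
  have h2 : |(∫ x, f x ∂(gaussianReal 0 1)) - ∫ x, h x ∂(gaussianReal 0 1)| ≤ τ := by
    rw [← integral_sub hf hh]
    have := norm_integral_le_of_norm_le_const (μ := gaussianReal 0 1)
      (f := fun x => f x - h x) (ae_of_all _ hfh)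
    simpa using this
  have h3 := abs_sub_abs_le_abs_sub (coordAvg ℓ m h z D - ∫ x, h x ∂(gaussianReal 0 1))
    (coordAvg ℓ m f z D - ∫ x, f x ∂(gaussianReal 0 1))
  have h4 := abs_sub (coordAvg ℓ m h z D - coordAvg ℓ m f z D)
    ((∫ x, h x ∂(gaussianReal 0 1)) - ∫ x, f x ∂(gaussianReal 0 1))
  rw [abs_sub_comm (coordAvg ℓ m h z D), abs_sub_comm (∫ x, h x ∂(gaussianReal 0 1))] at h4
  rw [sub_sub_sub_comm] at h3
  linarith

lemma integrable_min_abs {r : ℝ} (hr : 0 ≤ r) :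
    Integrable (fun x => min |x| r) (gaussianReal 0 1) :=
  Integrable.of_bound (by fun_prop) r (ae_of_all _ fun x => by
    rw [Real.norm_of_nonneg (le_min (abs_nonneg x) hr)]
    exact min_le_right _ _)

lemma measure_coordAvg_min_abs_le {ℓ m : ℕ} (hm : 0 < m) {η r : ℝ} (hη : 0 < η) (hr : 0 ≤ r)
    {b : ℝ≥0∞} (hU : ∀ {f f' : ℝ → ℝ} {B : ℝ}, IsTestFunction f f' B →
      diagMeasure ℓ m {D | ∃ z, ∑ i, z i ^ 2 = 1 ∧
        η ≤ |coordAvg ℓ m f z D - ∫ x, f x ∂(gaussianReal 0 1)|} ≤ b) :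
    diagMeasure ℓ m {D | ∃ z, ∑ i, z i ^ 2 = 1 ∧
      3 * η ≤ |coordAvg ℓ m (fun x => min |x| r) z D - ∫ x, min |x| r ∂(gaussianReal 0 1)|}
      ≤ b := by
  have hf := isTestFunction_smoothClip hr hη
  have hsub := setOf_coordAvg_subset ℓ hm (abs_smoothClip_sub_le r hη)
    (Integrable.of_bound hf.continuous.aestronglyMeasurable _ (ae_of_all _ hf.bound))
    (integrable_min_abs hr) η
  rw [show η + 2 * η = 3 * η by ring] at hsub
  exact (measure_mono hsub).trans (hU hf)

lemma isProbabilityMeasure_indexMeasure (ℓ : ℕ) {m : ℕ} (hm : 0 < m) (k : ℕ) :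
    IsProbabilityMeasure (indexMeasure ℓ m k) := by
  have := isProbabilityMeasure_unifIndex ℓ hm
  unfold indexMeasure
  infer_instance

/-- Concentration of the sampled averages, simultaneously for finitely many unit vectors. -/
lemma measure_exists_sampleAvg_sub_le (ℓ : ℕ) {m k n : ℕ} (hm : 0 < m) (hk : 0 < k) {h : ℝ → ℝ}
    (hh : Continuous h) {R : ℝ} (hR : 0 < R) (h0 : ∀ x, h x ∈ Set.Icc 0 R) {η t δ I : ℝ}
    (ht : 0 ≤ t) (hδ : 0 ≤ δ)
    (hU : diagMeasure ℓ m {D | ∃ z, ∑ i, z i ^ 2 = 1 ∧ η ≤ |coordAvg ℓ m h z D - I|}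
      ≤ ENNReal.ofReal (δ / 8))
    (hn : n * (2 * exp (-(2 * k * t ^ 2 / R ^ 2))) ≤ δ / 8) (z : Fin n → Fin (2 ^ ℓ) → ℝ) :
    ((diagMeasure ℓ m).prod (indexMeasure ℓ m k))
      {p | ∃ i, ∑ j, z i j ^ 2 = 1 ∧ η + t ≤ |sampleAvg ℓ m k h (z i) p.1 p.2 - I|}
      ≤ ENNReal.ofReal (δ / 4) := by
  have := isProbabilityMeasure_indexMeasure ℓ hm k
  set U := {D | ∃ z, ∑ i, z i ^ 2 = 1 ∧ η ≤ |coordAvg ℓ m h z D - I|}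
  have hsub : {p : (Fin m → Fin (2 ^ ℓ) → ℝ) × (Fin k → Fin m × Fin (2 ^ ℓ)) |
      ∃ i, ∑ j, z i j ^ 2 = 1 ∧ η + t ≤ |sampleAvg ℓ m k h (z i) p.1 p.2 - I|} ⊆
      U ×ˢ Set.univ ∪
        ⋃ i, {p | t ≤ |sampleAvg ℓ m k h (z i) p.1 p.2 - coordAvg ℓ m h (z i) p.1|} := by
    rintro p ⟨i, hz, hp⟩
    by_cases hc : t ≤ |sampleAvg ℓ m k h (z i) p.1 p.2 - coordAvg ℓ m h (z i) p.1|
    · exact Or.inr (Set.mem_iUnion.2 ⟨i, hc⟩)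
    · refine Or.inl ⟨⟨z i, hz, ?_⟩, trivial⟩
      have := abs_sub_le (sampleAvg ℓ m k h (z i) p.1 p.2) (coordAvg ℓ m h (z i) p.1) I
      linarith
  refine (measure_mono hsub).trans ((measure_union_le _ _).trans ?_)
  rw [Measure.prod_prod, measure_univ, mul_one, show δ / 4 = δ / 8 + δ / 8 by ring,
    ENNReal.ofReal_add (by positivity) (by positivity)]
  refine add_le_add hU ((measure_iUnion_fintype_le _ _).trans ?_)
  calc _ ≤ ∑ _i : Fin n, ENNReal.ofReal (2 * exp (-(2 * k * t ^ 2 / R ^ 2))) :=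
        Finset.sum_le_sum fun i _ => measure_sampleAvg_sub_le ℓ hm hk hh hR h0 (z i) ht
    _ ≤ _ := by
        rw [Finset.sum_const, Finset.card_univ, Fintype.card_fin, nsmul_eq_mul,
          natCast_mul_ofReal]
        exact ENNReal.ofReal_le_ofReal hn

/-- The sample size makes the union bound over `n` points affordable. -/
lemma natCast_mul_exp_le {c₀ C ε δ : ℝ} (hc₀ : 0 < c₀) (hC : 250 / c₀ ^ 2 ≤ C)
    (hε : ε ∈ Set.Ioo (0 : ℝ) (1 / 2)) (hδ : δ ∈ Set.Ioo (0 : ℝ) (1 / 2)) {ℓ n k : ℕ}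
    (hk : C * ε⁻¹ ^ 2 * (Real.log n + Real.log (1 / δ)) * Real.log (2 ^ ℓ / (ε * δ)) ^ 1 ≤ k) :
    0 < k ∧ n * (2 * exp (-(2 * k * (c₀ * ε) ^ 2 / (10 * √(Real.log (1 / ε))) ^ 2))) ≤ δ / 8 := by
  obtain ⟨hε0, hε1⟩ := hε
  obtain ⟨hδ0, hδ1⟩ := hδ
  have hE := half_le_log_one_div (δ := ε) ⟨hε0, hε1⟩
  have hF := half_le_log_one_div (δ := δ) ⟨hδ0, hδ1⟩
  have hn0 : 0 ≤ Real.log n := Real.log_natCast_nonneg n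
  have hΛ : Real.log (1 / ε) ≤ Real.log (2 ^ ℓ / (ε * δ)) := by
    refine Real.log_le_log (by positivity) ?_
    have hd : (1 : ℝ) ≤ 2 ^ ℓ := one_le_pow₀ (by norm_num)
    refine div_le_div₀ (by positivity) hd (by positivity) ?_
    nlinarith
  rw [pow_one] at hk
  have hC0 : 0 < C := lt_of_lt_of_le (by positivity) hC
  have hk1 : C * ε⁻¹ ^ 2 * (Real.log n + Real.log (1 / δ)) * Real.log (1 / ε) ≤ k :=
    le_trans (mul_le_mul_of_nonneg_left hΛ (by positivity)) hk
  have hk0 : (0 : ℝ) < k := lt_of_lt_of_le (by positivity) hk1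
  refine ⟨by exact_mod_cast hk0, ?_⟩
  rcases Nat.eq_zero_or_pos n with rfl | hn
  · simp; positivity
  have hn' : (0 : ℝ) < n := by exact_mod_cast hn
  have hexp : Real.log n + Real.log (1 / δ) + Real.log 16
      ≤ 2 * k * (c₀ * ε) ^ 2 / (10 * √(Real.log (1 / ε))) ^ 2 := by
    have h16 : Real.log 16 ≤ 4 * Real.log (1 / δ) := by
      rw [show (16 : ℝ) = 2 ^ 4 by norm_num, Real.log_pow]
      have := Real.log_le_log (by norm_num) (show (2 : ℝ) ≤ 1 / δ by
        rw [le_div_iff₀ hδ0]; linarith)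
      push_cast
      linarith
    rw [mul_pow (10 : ℝ), sq_sqrt (by positivity), le_div_iff₀ (by positivity)]
    rw [div_le_iff₀ (by positivity)] at hC
    calc _ ≤ (5 * (Real.log n + Real.log (1 / δ))) * (10 ^ 2 * Real.log (1 / ε)) := by
          gcongr; linarith
      _ = 2 * 250 * (Real.log n + Real.log (1 / δ)) * Real.log (1 / ε) := by ring
      _ ≤ 2 * (C * c₀ ^ 2) * (Real.log n + Real.log (1 / δ)) * Real.log (1 / ε) := by gcongr
      _ = 2 * (C * ε⁻¹ ^ 2 * (Real.log n + Real.log (1 / δ)) * Real.log (1 / ε))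
          * (c₀ * ε) ^ 2 := by field_simp
      _ ≤ _ := by gcongr
  have hfin : exp (-(2 * k * (c₀ * ε) ^ 2 / (10 * √(Real.log (1 / ε))) ^ 2))
      ≤ δ / (16 * n) := by
    calc _ ≤ exp (-(Real.log n + Real.log (1 / δ) + Real.log 16)) :=
          exp_le_exp.2 (neg_le_neg hexp)
      _ = _ := by
        rw [exp_neg, exp_add, exp_add, exp_log hn', exp_log (by positivity),
          exp_log (by norm_num)]
        field_simp
  calc _ ≤ n * (2 * (δ / (16 * n))) := by gcongr
    _ = δ / 8 := by field_simp; norm_num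

lemma sum_sq_div_norm_sub {ι : Type*} [Fintype ι] {q x : EuclideanSpace ℝ ι} (h : q ≠ x) :
    ∑ j, ((q j - x j) / ‖q - x‖) ^ 2 = 1 := by
  have h0 : ‖q - x‖ ≠ 0 := norm_ne_zero_iff.2 (sub_ne_zero.2 h)
  simp_rw [div_pow]
  rw [← Finset.sum_div, div_eq_one_iff_eq (pow_ne_zero 2 h0), EuclideanSpace.real_norm_sq_eq]
  rfl

lemma sqrt_pi_div_two_mul : √(π / 2) * √(2 / π) = 1 := by
  rw [← sqrt_mul (by positivity), sqrt_eq_one]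
  field_simp

lemma sqrt_pi_div_two_le : √(π / 2) ≤ 13 / 10 :=
  sqrt_le_iff.2 ⟨by norm_num, by nlinarith [pi_lt_d2]⟩

/-- The clipped averages, rescaled, approximate `1` with relative error `ε`. -/
lemma one_sub_le_sqrt_mul {ε A : ℝ} (hε : ε ∈ Set.Ioo (0 : ℝ) (1 / 2))
    (hA : |A - ∫ x, min |x| (2 * √(Real.log (1 / ε))) ∂(gaussianReal 0 1)| ≤ ε / 5) :
    1 - ε ≤ √(π / 2) * A := by
  obtain ⟨hε0, hε1⟩ := hε
  have hE := half_le_log_one_div (δ := ε) ⟨hε0, hε1⟩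
  have hr : 1 ≤ 2 * √(Real.log (1 / ε)) := by
    have : 1 / 2 ≤ √(Real.log (1 / ε)) := le_sqrt_of_sq_le (by linarith)
    linarith
  have h1 := le_integral_min_abs hr
  have h2 : exp (-((2 * √(Real.log (1 / ε))) ^ 2 / 2)) = ε ^ 2 := by
    rw [mul_pow, sq_sqrt (by linarith), one_div, Real.log_inv,
      show -(2 ^ 2 * -Real.log ε / 2) = Real.log ε + Real.log ε by ring, exp_add, exp_log hε0, sq]
  rw [h2] at h1
  have h3 : √(2 / π) - ε ^ 2 - ε / 5 ≤ A := by linarith [(abs_le.1 hA).1]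
  have h4 := mul_le_mul_of_nonneg_left h3 (sqrt_nonneg (π / 2))
  have h5 := mul_le_mul_of_nonneg_right sqrt_pi_div_two_le
    (by positivity : 0 ≤ ε ^ 2 + ε / 5)
  nlinarith [sqrt_pi_div_two_mul]

lemma sqrt_mul_le_one_add {ε r A : ℝ} (hε : 0 < ε)
    (hA : |A - ∫ x, min |x| r ∂(gaussianReal 0 1)| ≤ ε / 5) :
    √(π / 2) * A ≤ 1 + ε := by
  have h3 : A ≤ √(2 / π) + ε / 5 := by linarith [(abs_le.1 hA).2, integral_min_abs_le r]
  have h4 := mul_le_mul_of_nonneg_left h3 (sqrt_nonneg (π / 2))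
  have h5 := mul_le_mul_of_nonneg_right sqrt_pi_div_two_le (by positivity : 0 ≤ ε / 5)
  nlinarith [sqrt_pi_div_two_mul]

lemma sampleAvg_div (ℓ m k : ℕ) (f : ℝ → ℝ) (K : ℝ) (z : Fin (2 ^ ℓ) → ℝ)
    (D : Fin m → Fin (2 ^ ℓ) → ℝ) (L : Fin k → Fin m × Fin (2 ^ ℓ)) :
    sampleAvg ℓ m k (fun x => f x / K) z D L = sampleAvg ℓ m k f z D L / K := by
  unfold sampleAvg
  rw [← Finset.sum_div, mul_div_assoc]

/-- Theorem 1.3, query correctness: with high probability all `n`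
distance estimates are `(1 ± ε)`-accurate. -/
theorem distance_estimation_correct :
    ∃ C : ℝ, 0 < C ∧ ∃ c : ℕ, 0 < c ∧
      ∀ (ℓ : ℕ) (ε δ : ℝ), ε ∈ Set.Ioo (0 : ℝ) (1 / 2) → δ ∈ Set.Ioo (0 : ℝ) (1 / 2) →
        ∀ (n : ℕ) (x : Fin n → EuclideanSpace ℝ (Fin (2 ^ ℓ)))
          (q : EuclideanSpace ℝ (Fin (2 ^ ℓ))) (m k : ℕ),
          C * ε⁻¹ ^ 2 * Real.log (2 ^ ℓ / ε) ^ 5 * Real.log (1 / δ) ≤ (m : ℝ) →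
          C * ε⁻¹ ^ 2 * (Real.log n + Real.log (1 / δ)) *
              Real.log (2 ^ ℓ / (ε * δ)) ^ c ≤ (k : ℝ) →
          ENNReal.ofReal (1 - δ) ≤
            ((diagMeasure ℓ m).prod (indexMeasure ℓ m k))
              {p | ∀ i : Fin n,
                (1 - ε) * ‖q - x i‖ ≤ distEstimate ℓ m k ε p.1 p.2 q (x i) ∧
                  distEstimate ℓ m k ε p.1 p.2 q (x i) ≤ (1 + ε) * ‖q - x i‖} := by
  obtain ⟨K, hK1, hK⟩ := exists_abs_deriv_smoothTransition_le
  have hK0 : 0 < K := by linarith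
  have hg1 := one_sub_gaussAlpha_lt_integral
  have hg4 := integral_lt_one_sub_gaussAlpha
  set I₁ := ∫ x, smoothTransition (x - 1) ∂(gaussianReal 0 1) with hI₁
  set I₄ := ∫ x, smoothTransition (x - 4) ∂(gaussianReal 0 1) with hI₄
  obtain ⟨c₀, hc0, hc20, hc1, hc4⟩ : ∃ c₀ : ℝ, 0 < c₀ ∧ c₀ ≤ 1 / 20 ∧
      c₀ ≤ (I₁ - (1 - gaussAlpha)) / K ∧ c₀ ≤ ((1 - gaussAlpha) - I₄) / K :=
    ⟨min (1 / 20) (min ((I₁ - (1 - gaussAlpha)) / K) (((1 - gaussAlpha) - I₄) / K)),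
      lt_min (by norm_num) (lt_min (div_pos (by linarith) hK0) (div_pos (by linarith) hK0)),
      min_le_left _ _, (min_le_right _ _).trans (min_le_left _ _),
      (min_le_right _ _).trans (min_le_right _ _)⟩
  obtain ⟨C, hC, hmain⟩ := exists_measure_coordAvg_le (c₀ := c₀) ⟨hc0, by linarith⟩
  refine ⟨max C (250 / c₀ ^ 2), lt_max_of_lt_left hC, 1, one_pos, ?_⟩
  intro ℓ ε δ hε hδ n x q m k hm hk
  have hε0 := hε.1
  have hδ0 := hδ.1
  have hE := half_le_log_one_div hε
  have hF := half_le_log_one_div hδ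
  have hG := half_le_log_two_pow_div ℓ hε
  obtain ⟨hm0, hU⟩ := hmain ℓ ε δ hε hδ m (le_trans (by gcongr; exact le_max_left _ _) hm)
  obtain ⟨hk0, hn⟩ := natCast_mul_exp_le hc0 (le_max_right _ _) hε hδ hk
  have hη : 0 < c₀ * ε := by positivity
  set s := √(Real.log (1 / ε)) with hs
  have hs2 : 1 / 2 ≤ s := le_sqrt_of_sq_le (by linarith)
  have hR : 0 < 10 * s := by linarith
  have := isProbabilityMeasure_indexMeasure ℓ hm0 k
  set μ := (diagMeasure ℓ m).prod (indexMeasure ℓ m k) with hμ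
  let z : Fin n → Fin (2 ^ ℓ) → ℝ := fun i j => (q j - x i j) / ‖q - x i‖
  have hclip : ∀ r, 0 ≤ r → r ≤ 10 * s →
      μ {p | ∃ i, ∑ j, z i j ^ 2 = 1 ∧ 3 * (c₀ * ε) + c₀ * ε ≤
        |sampleAvg ℓ m k (fun y => min |y| r) (z i) p.1 p.2
          - ∫ y, min |y| r ∂(gaussianReal 0 1)|} ≤ ENNReal.ofReal (δ / 4) := fun r hr hr' =>
    measure_exists_sampleAvg_sub_le ℓ hm0 hk0 (by fun_prop) hR
      (fun y => ⟨le_min (abs_nonneg y) hr, (min_le_right _ _).trans hr'⟩) hη.le hδ0.le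
      (measure_coordAvg_min_abs_le hm0 hη hr hU) hn z
  have htail : ∀ a, μ {p | ∃ i, ∑ j, z i j ^ 2 = 1 ∧ c₀ * ε + c₀ * ε ≤
      |sampleAvg ℓ m k (fun y => smoothTransition (y - a) / K) (z i) p.1 p.2
        - ∫ y, smoothTransition (y - a) / K ∂(gaussianReal 0 1)|}
      ≤ ENNReal.ofReal (δ / 4) := fun a => by
    have hf := isTestFunction_smoothTransition hK1 hK a
    refine measure_exists_sampleAvg_sub_le ℓ hm0 hk0 hf.continuous hR
      (fun y => ⟨div_nonneg (smoothTransition.nonneg _) hK0.le, ?_⟩) hη.le hδ0.le (hU hf) hn z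
    exact ((le_abs_self _).trans (hf.bound y)).trans (by linarith)
  set S := {p : (Fin m → Fin (2 ^ ℓ) → ℝ) × (Fin k → Fin m × Fin (2 ^ ℓ)) | ∀ i : Fin n,
    (1 - ε) * ‖q - x i‖ ≤ distEstimate ℓ m k ε p.1 p.2 q (x i) ∧
      distEstimate ℓ m k ε p.1 p.2 q (x i) ≤ (1 + ε) * ‖q - x i‖} with hS
  have hbad : μ Sᶜ ≤ ENNReal.ofReal δ := by
    have h1 := hclip (2 * s) (by linarith) (by linarith)
    have h2 := hclip (10 * s) hR.le le_rfl
    have h3 := htail 1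
    have h4 := htail 4
    rw [show δ = δ / 4 + δ / 4 + (δ / 4 + δ / 4) by ring, ENNReal.ofReal_add (by positivity)
      (by positivity), ENNReal.ofReal_add (by positivity) (by positivity)]
    refine le_trans (measure_mono fun p hp => ?_) ((measure_union_le _ _).trans (add_le_add
      ((measure_union_le _ _).trans (add_le_add h1 h2))
      ((measure_union_le _ _).trans (add_le_add h3 h4))))
    by_contra hgood
    simp only [Set.mem_union, Set.mem_ofPred_eq, not_or, not_exists, not_and, not_le] at hgood
    obtain ⟨⟨hp1, hp2⟩, hp3, hp4⟩ := hgood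
    refine hp fun i => ?_
    by_cases hqx : q = x i
    · rw [← hqx, distEstimate_self]
      simp
    have hz : ∑ j, z i j ^ 2 = 1 := sum_sq_div_norm_sub hqx
    have hρ : 0 < ‖q - x i‖ := norm_pos_iff.2 (sub_ne_zero.2 hqx)
    have hc : c₀ * ε + c₀ * ε ≤ c₀ := by nlinarith [hε.2]
    have hd1 := (abs_lt.1 ((hp3 i hz).trans_le hc)).1
    have hd4 := (abs_lt.1 ((hp4 i hz).trans_le hc)).2
    rw [sampleAvg_div, integral_div, ← sub_div, lt_div_iff₀ hK0] at hd1
    rw [sampleAvg_div, integral_div, ← sub_div, div_lt_iff₀ hK0] at hd4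
    rw [le_div_iff₀ hK0] at hc1 hc4
    obtain ⟨hl, hu⟩ := distEstimate_mem_Icc hk0 ε hρ (D := p.1) (L := p.2) (q := q) (x := x i)
      (by linarith) (by linarith)
    have h5 : 3 * (c₀ * ε) + c₀ * ε ≤ ε / 5 := by nlinarith
    exact ⟨(mul_le_mul_of_nonneg_right (one_sub_le_sqrt_mul hε ((hp1 i hz).le.trans h5))
      hρ.le).trans hl, hu.trans (mul_le_mul_of_nonneg_right
        (sqrt_mul_le_one_add hε0 ((hp2 i hz).le.trans h5)) hρ.le)⟩
  have htot : 1 ≤ μ S + μ Sᶜ := by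
    rw [← measure_univ (μ := μ), ← Set.union_compl_self S]
    exact measure_union_le _ _
  rw [ENNReal.ofReal_sub 1 hδ0.le, ENNReal.ofReal_one, tsub_le_iff_right]
  exact htot.trans (add_le_add_right hbad _)
end
end

section
/- Let g_1, …, g_n be i.i.d. random vectors in ℝ^d with g_i ∼ N(0, I_d), let ε ∈ (0, 1), and assume d ≥ 40 and n ≤ (2ε)⁻² d. Then there exists a 1-Lipschitz function f : ℝ → ℝ (in fact f(x) = x) such that with probability at least 9/10 there exists z ∈ ℝ^d with ‖z‖ ≤ 1 satisfying |(1/n) Σ_{i=1}^n f(⟨z, g_i⟩) − E_{Z ∼ N(0, ‖z‖²)}[f(Z)]| ≥ ε. -/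
open MeasureTheory ProbabilityTheory Real
open scoped ENNReal NNReal Classical

noncomputable section

/-- The joint law of `n` i.i.d. standard Gaussian vectors in `ℝ^d`. -/
def gaussVecMeasure (d n : ℕ) : Measure (Fin n → Fin d → ℝ) :=
  Measure.pi fun _ => Measure.pi fun _ => gaussianReal 0 1

instance (d n : ℕ) : IsProbabilityMeasure (gaussVecMeasure d n) :=
  inferInstanceAs (IsProbabilityMeasure (Measure.pi _))

/-- The sum of the `n` vectors is a Gaussian vector with i.i.d. `N(0, n)` coordinates. -/
lemma map_sum_gaussVecMeasure (d n : ℕ) :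
    (gaussVecMeasure d n).map (fun g => ∑ i, WithLp.toLp 2 (g i)) =
      (Measure.pi fun _ : Fin d => gaussianReal 0 (n : ℝ≥0)).map (WithLp.toLp 2) := by
  apply Measure.ext_of_charFun
  ext t
  have hind : iIndepFun (fun (i : Fin n) (g : Fin n → Fin d → ℝ) => WithLp.toLp 2 (g i))
      (gaussVecMeasure d n) :=
    iIndepFun_pi (X := fun _ x => WithLp.toLp 2 x) fun _ => by fun_prop
  have hmap (i : Fin n) : (gaussVecMeasure d n).map (fun g => WithLp.toLp 2 (g i)) =
      (Measure.pi fun _ : Fin d => gaussianReal 0 1).map (WithLp.toLp 2) := by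
    have h := (measurePreserving_eval
      (fun _ : Fin n => Measure.pi fun _ : Fin d => gaussianReal 0 1) i).map_eq
    rw [← h, Measure.map_map (by fun_prop) (by fun_prop)]
    rfl
  rw [hind.charFun_map_fun_sum_eq_prod fun i => Measurable.aemeasurable (by fun_prop),
    Finset.prod_apply]
  simp_rw [hmap, charFun_pi, charFun_gaussianReal, ← Complex.exp_sum]
  simp [Finset.mul_sum, mul_div_assoc]

lemma integral_exp_neg_sq_gaussianReal {v : ℝ≥0} (hv : v ≠ 0) :
    ∫ x, exp (-(3 / (2 * v)) * x ^ 2) ∂gaussianReal 0 v = 1 / 2 := by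
  have hv' : (0 : ℝ) < v := by positivity
  rw [integral_gaussianReal_eq_integral_smul hv]
  have h (x : ℝ) : gaussianPDFReal 0 v x • exp (-(3 / (2 * v)) * x ^ 2) =
      (√(2 * π * v))⁻¹ * exp (-(2 / v) * x ^ 2) := by
    rw [gaussianPDFReal, smul_eq_mul, mul_assoc, ← exp_add]
    congr 2
    field_simp
    ring
  simp_rw [h]
  rw [integral_const_mul, integral_gaussian, ← Real.sqrt_inv, ← Real.sqrt_mul (by positivity),
    show (2 * π * v)⁻¹ * (π / (2 / v)) = (1 / 2 : ℝ) ^ 2 by field_simp,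
    Real.sqrt_sq (by norm_num)]

/-- Chernoff lower-tail bound for the squared norm of a Gaussian vector. -/
lemma pi_gaussianReal_sum_sq_le {d : ℕ} (hd : 40 ≤ d) {v : ℝ≥0} (hv : v ≠ 0) :
    (Measure.pi fun _ : Fin d => gaussianReal 0 v).real
      {x | ∑ j, x j ^ 2 ≤ v * d / 4} ≤ 1 / 10 := by
  set μ := Measure.pi fun _ : Fin d => gaussianReal 0 v
  have hv' : (0 : ℝ) < v := by positivity
  have hint : Integrable (fun x : Fin d → ℝ => ∏ j, exp (-(3 / (2 * v)) * x j ^ 2)) μ := by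
    refine .of_bound (Measurable.aestronglyMeasurable (by fun_prop)) 1 (.of_forall fun x => ?_)
    rw [norm_of_nonneg (by positivity)]
    refine Finset.prod_le_one (fun _ _ => by positivity) fun j _ => exp_le_one_iff.2 ?_
    rw [neg_mul]
    exact neg_nonpos.2 (by positivity)
  have hmarkov := mul_meas_ge_le_integral_of_nonneg
    (.of_forall fun x => by positivity) hint (exp (-(3 * d / 8)))
  rw [integral_fintype_prod_eq_prod
    (f := fun (_ : Fin d) (x : ℝ) => exp (-(3 / (2 * v)) * x ^ 2))] at hmarkov
  simp_rw [integral_exp_neg_sq_gaussianReal hv] at hmarkov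
  rw [Finset.prod_const, Finset.card_univ, Fintype.card_fin] at hmarkov
  have hset : {x : Fin d → ℝ | ∑ j, x j ^ 2 ≤ v * d / 4} ⊆
      {x | exp (-(3 * d / 8)) ≤ ∏ j, exp (-(3 / (2 * v)) * x j ^ 2)} := by
    intro x hx
    simp only [Set.mem_ofPred_eq] at hx ⊢
    rw [← exp_sum, exp_le_exp, ← Finset.mul_sum, neg_mul, neg_le_neg_iff]
    calc 3 / (2 * (v : ℝ)) * ∑ j, x j ^ 2 ≤ 3 / (2 * v) * (v * d / 4) := by gcongr
      _ = 3 * d / 8 := by field_simp; norm_num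
  have hexp : exp (3 / 8) ≤ 3 / 2 := by
    have h : exp (3 / 8) ^ 8 ≤ (3 / 2) ^ 8 := by
      rw [← exp_nat_mul, show ((8 : ℕ) : ℝ) * (3 / 8) = (3 : ℕ) * 1 by norm_num, exp_nat_mul]
      calc exp 1 ^ 3 ≤ 2.8 ^ 3 := by
            gcongr
            exact exp_one_lt_d9.le.trans (by norm_num)
        _ ≤ _ := by norm_num
    exact le_of_pow_le_pow_left₀ (by norm_num) (by norm_num) h
  calc μ.real {x | ∑ j, x j ^ 2 ≤ v * d / 4}
      ≤ μ.real {x | exp (-(3 * d / 8)) ≤ ∏ j, exp (-(3 / (2 * v)) * x j ^ 2)} :=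
        measureReal_mono hset
    _ = exp (3 * d / 8) * (exp (-(3 * d / 8)) *
          μ.real {x | exp (-(3 * d / 8)) ≤ ∏ j, exp (-(3 / (2 * v)) * x j ^ 2)}) := by
        rw [← mul_assoc, ← exp_add, add_neg_cancel, exp_zero, one_mul]
    _ ≤ exp (3 * d / 8) * (1 / 2) ^ d := by gcongr
    _ = (exp (3 / 8) * (1 / 2)) ^ d := by
        rw [mul_pow, ← exp_nat_mul]
        congr 2
        ring
    _ ≤ (3 / 2 * (1 / 2)) ^ d := by gcongr
    _ ≤ (3 / 2 * (1 / 2)) ^ 40 := pow_le_pow_of_le_one (by norm_num) (by norm_num) hd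
    _ ≤ 1 / 10 := by norm_num

lemma le_gaussVecMeasure_norm_sum {d n : ℕ} (hd : 40 ≤ d) (hn : n ≠ 0) :
    ENNReal.ofReal (9 / 10) ≤ gaussVecMeasure d n
      {g | (n * d / 4 : ℝ) < ‖∑ i, WithLp.toLp 2 (g i)‖ ^ 2} := by
  have hmeas : MeasurableSet {y : EuclideanSpace ℝ (Fin d) | (n * d / 4 : ℝ) < ‖y‖ ^ 2} :=
    measurableSet_lt measurable_const (by fun_prop)
  have h := congrArg (fun μ => μ {y | (n * d / 4 : ℝ) < ‖y‖ ^ 2}) (map_sum_gaussVecMeasure d n)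
  rw [Measure.map_apply (by fun_prop) hmeas, Measure.map_apply (by fun_prop) hmeas] at h
  refine le_of_le_of_eq ?_ h.symm
  have hn' : (n : ℝ≥0) ≠ 0 := by exact_mod_cast hn
  have htail := pi_gaussianReal_sum_sq_le hd hn'
  have hcompl : WithLp.toLp 2 ⁻¹' {y : EuclideanSpace ℝ (Fin d) | (n * d / 4 : ℝ) < ‖y‖ ^ 2} =
      {x : Fin d → ℝ | ∑ j, x j ^ 2 ≤ (n : ℝ≥0) * d / 4}ᶜ := by
    ext x
    simp [EuclideanSpace.real_norm_sq_eq]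
  rw [hcompl, ENNReal.ofReal_le_iff_le_toReal (measure_ne_top _ _), ← measureReal_def,
    probReal_compl_eq_one_sub (measurableSet_le (by fun_prop) measurable_const)]
  linarith

/-- Theorem A.2: lower bound on the embedding dimension for uniform
Lipschitz concentration with truly Gaussian matrices. -/
theorem gaussian_lower_bound (d n : ℕ) (ε : ℝ) (hε : ε ∈ Set.Ioo (0 : ℝ) 1)
    (hd : 40 ≤ d) (hn : (n : ℝ) ≤ (2 * ε)⁻¹ ^ 2 * d) :
    ∃ f : ℝ → ℝ, LipschitzWith 1 f ∧
      ENNReal.ofReal (9 / 10) ≤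
        gaussVecMeasure d n
          {g | ∃ z : EuclideanSpace ℝ (Fin d), ‖z‖ ≤ 1 ∧
            ε ≤ |(1 / (n : ℝ)) * ∑ i, f (∑ j, z j * g i j) -
                ∫ x, f x ∂(gaussianReal 0 (‖z‖₊ ^ 2))|} := by
  rcases eq_or_ne n 0 with rfl | hn0
  · refine ⟨fun _ => 1, LipschitzWith.const' 1, ?_⟩
    have huniv : {g : Fin 0 → Fin d → ℝ | ∃ z : EuclideanSpace ℝ (Fin d), ‖z‖ ≤ 1 ∧
        ε ≤ |(1 / ((0 : ℕ) : ℝ)) * ∑ _i : Fin 0, (1 : ℝ) -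
          ∫ _x, (1 : ℝ) ∂(gaussianReal 0 (‖z‖₊ ^ 2))|} = Set.univ :=
      Set.eq_univ_of_forall fun g => ⟨0, by simp, by simpa using hε.2.le⟩
    rw [huniv, measure_univ]
    exact ENNReal.ofReal_le_one.2 (by norm_num)
  refine ⟨id, LipschitzWith.id, (le_gaussVecMeasure_norm_sum hd hn0).trans (measure_mono ?_)⟩
  intro g hg
  set S : EuclideanSpace ℝ (Fin d) := ∑ i, WithLp.toLp 2 (g i) with hS
  change (n * d / 4 : ℝ) < ‖S‖ ^ 2 at hg
  have hε0 := hε.1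
  have hnpos : (0 : ℝ) < n := by positivity
  have hSpos : 0 < ‖S‖ := by
    by_contra! h
    have : ‖S‖ = 0 := le_antisymm h (norm_nonneg _)
    rw [this] at hg
    have : (0 : ℝ) ≤ n * d / 4 := by positivity
    linarith
  have hle : ε * n ≤ ‖S‖ := by
    refine le_of_pow_le_pow_left₀ two_ne_zero hSpos.le ?_
    calc (ε * n) ^ 2 = ε ^ 2 * n * n := by ring
      _ ≤ ε ^ 2 * n * ((2 * ε)⁻¹ ^ 2 * d) := by gcongr
      _ = n * d / 4 := by field_simp; norm_num
      _ ≤ ‖S‖ ^ 2 := hg.le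
  refine ⟨‖S‖⁻¹ • S, ?_, ?_⟩
  · rw [norm_smul, norm_inv, norm_norm, inv_mul_cancel₀ hSpos.ne']
  have hsum : ∑ i, ∑ j, (‖S‖⁻¹ • S) j * g i j = ‖S‖ := by
    rw [Finset.sum_comm]
    have hcoord (j : Fin d) : ∑ i, (‖S‖⁻¹ • S) j * g i j = ‖S‖⁻¹ * S j ^ 2 := by
      rw [← Finset.mul_sum]
      have : ∑ i, g i j = S j := by simp [hS]
      rw [this, PiLp.smul_apply, smul_eq_mul]
      ring
    simp_rw [hcoord]
    rw [← Finset.mul_sum, ← EuclideanSpace.real_norm_sq_eq]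
    field_simp
  simp only [id_eq, hsum, integral_id_gaussianReal, sub_zero]
  rw [abs_of_nonneg (by positivity), one_div, inv_mul_eq_div, le_div_iff₀ hnpos]
  exact hle
end
end
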